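/- Let α ∈ (0,1) with α ≠ 1/2, and suppose α is rational or transcendental. Then the Hurwitz zeta function ζ(s,α) has infinitely many zeros in the half-plane Re s > 1: the set { s ∈ ℂ | Re s > 1 and ζ(s,α) = 0 } is infinite. -/

import Mathlib

open Real Filter Set HurwitzZeta
open MeasureTheory Topology

/-- The mean value over `[0, T]` of a nonconstant exponential tends to `0`. -/
theorem tendsto_mean_cexp {c : ℝ} (hc : c ≠ 0) :
    Tendsto (fun T : ℝ ↦ (T : ℂ)⁻¹ * ∫ t in (0 : ℝ)..T, Complex.exp ((c * Complex.I) * t))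
      atTop (𝓝 0) := by
  have hc' : (c : ℂ) * Complex.I ≠ 0 := by simp [hc]
  rw [tendsto_zero_iff_norm_tendsto_zero]
  refine squeeze_zero' (g := fun T : ℝ ↦ T⁻¹ * (2 / |c|)) (Eventually.of_forall fun _ ↦ norm_nonneg _)
    ?_ (by simpa using tendsto_inv_atTop_zero.mul_const (2 / |c|))
  filter_upwards [eventually_gt_atTop 0] with T hT
  rw [integral_exp_mul_complex hc', norm_mul, norm_inv, Complex.norm_real, norm_div, norm_mul,
    Complex.norm_I, mul_one, Complex.norm_real, Real.norm_eq_abs, Real.norm_eq_abs, abs_of_pos hT]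
  gcongr
  refine (norm_sub_le _ _).trans ?_
  have (u : ℝ) : ‖Complex.exp (c * Complex.I * u)‖ = 1 := by
    rw [mul_right_comm, ← Complex.ofReal_mul, Complex.norm_exp_ofReal_mul_I]
  rw [this, this]; norm_num

/-- Weyl's criterion for the linear flow in an incommensurable direction on a torus. -/
theorem tendsto_mean_linear_flow {d : Type*} [Fintype d] {x : d → ℝ}
    (hx : ∀ n : d → ℤ, ∑ i, n i * x i = 0 → n = 0) (g : C(UnitAddTorus d, ℂ)) :
    Tendsto (fun T : ℝ ↦ (T : ℂ)⁻¹ *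
      ∫ t in (0 : ℝ)..T, g (fun i ↦ ((t * x i : ℝ) : UnitAddCircle))) atTop
      (𝓝 (∫ y, g y ∂(Measure.pi fun _ : d ↦ (AddCircle.haarAddCircle : Measure UnitAddCircle)))) := by
  set μ := Measure.pi fun _ : d ↦ (AddCircle.haarAddCircle : Measure UnitAddCircle) with hμ
  have hcont : Continuous fun t : ℝ ↦ (fun i ↦ ((t * x i : ℝ) : UnitAddCircle) : UnitAddTorus d) :=
    continuous_pi fun i ↦ (AddCircle.continuous_mk' 1).comp (by fun_prop)
  have hint (g : C(UnitAddTorus d, ℂ)) (a b : ℝ) : IntervalIntegrable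
      (fun t : ℝ ↦ g (fun i ↦ ((t * x i : ℝ) : UnitAddCircle))) volume a b :=
    (g.continuous.comp hcont).intervalIntegrable _ _
  have hintμ (g : C(UnitAddTorus d, ℂ)) : Integrable g μ :=
    g.continuous.integrable_of_hasCompactSupport (HasCompactSupport.of_compactSpace _)
  let S : Submodule ℂ C(UnitAddTorus d, ℂ) :=
    { carrier := {g | Tendsto (fun T : ℝ ↦ (T : ℂ)⁻¹ *
        ∫ t in (0 : ℝ)..T, g (fun i ↦ ((t * x i : ℝ) : UnitAddCircle))) atTop (𝓝 (∫ y, g y ∂μ))}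
      add_mem' := by
        intro g h hg hh
        simp only [mem_ofPred_eq, ContinuousMap.add_apply] at *
        rw [integral_add (hintμ g) (hintμ h)]
        refine (hg.add hh).congr fun T ↦ ?_
        rw [intervalIntegral.integral_add (hint g _ _) (hint h _ _), mul_add]
      zero_mem' := by simp
      smul_mem' := by
        intro c g hg
        simp only [mem_ofPred_eq, ContinuousMap.smul_apply, smul_eq_mul] at *
        rw [integral_const_mul]
        refine (hg.const_mul c).congr fun T ↦ ?_
        rw [intervalIntegral.integral_const_mul]; ring }
  have hbound (g : C(UnitAddTorus d, ℂ)) {T : ℝ} (hT : 0 < T) : ‖(T : ℂ)⁻¹ *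
      ∫ t in (0 : ℝ)..T, g (fun i ↦ ((t * x i : ℝ) : UnitAddCircle))‖ ≤ ‖g‖ := by
    rw [norm_mul, norm_inv, Complex.norm_real, Real.norm_eq_abs, abs_of_pos hT, inv_mul_le_iff₀ hT]
    have := intervalIntegral.norm_integral_le_of_norm_le_const
      (f := fun t : ℝ ↦ g (fun i ↦ ((t * x i : ℝ) : UnitAddCircle))) (a := 0) (b := T) (C := ‖g‖)
      (fun t _ ↦ g.norm_coe_le_norm _)
    rwa [sub_zero, abs_of_pos hT, mul_comm] at this
  have hboundμ (g : C(UnitAddTorus d, ℂ)) : ‖∫ y, g y ∂μ‖ ≤ ‖g‖ := by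
    simpa using norm_integral_le_of_norm_le_const (μ := μ) (f := g)
      (Eventually.of_forall fun y ↦ g.norm_coe_le_norm y)
  have hclosed : IsClosed (S : Set C(UnitAddTorus d, ℂ)) := by
    rw [← closure_subset_iff_isClosed]
    intro g hg
    change Tendsto _ _ _
    rw [Metric.tendsto_nhds]
    intro ε hε
    obtain ⟨h, hh, hgh⟩ := Metric.mem_closure_iff.1 hg (ε / 3) (by positivity)
    rw [dist_eq_norm] at hgh
    have hh' : Tendsto _ _ _ := hh
    filter_upwards [Metric.tendsto_nhds.1 hh' (ε / 3) (by positivity), eventually_gt_atTop 0]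
      with T hT hT0
    have h1 := hbound (g - h) hT0
    have h2 := hboundμ (g - h)
    simp only [ContinuousMap.sub_apply] at h1 h2
    rw [intervalIntegral.integral_sub (hint g _ _) (hint h _ _), mul_sub] at h1
    rw [integral_sub (hintμ g) (hintμ h)] at h2
    rw [dist_eq_norm] at hT ⊢
    rw [← norm_neg, neg_sub] at h2
    calc _ = ‖((T : ℂ)⁻¹ * (∫ t in (0 : ℝ)..T, g (fun i ↦ ((t * x i : ℝ) : UnitAddCircle))) -
            (T : ℂ)⁻¹ * ∫ t in (0 : ℝ)..T, h (fun i ↦ ((t * x i : ℝ) : UnitAddCircle))) +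
          ((T : ℂ)⁻¹ * (∫ t in (0 : ℝ)..T, h (fun i ↦ ((t * x i : ℝ) : UnitAddCircle))) -
            ∫ y, h y ∂μ) + (∫ y, h y ∂μ - ∫ y, g y ∂μ)‖ := by congr 1; ring
      _ ≤ ‖g - h‖ + ‖(T : ℂ)⁻¹ *
          (∫ t in (0 : ℝ)..T, h (fun i ↦ ((t * x i : ℝ) : UnitAddCircle))) - ∫ y, h y ∂μ‖ +
          ‖g - h‖ := norm_add₃_le.trans (add_le_add (add_le_add h1 le_rfl) h2)
      _ < ε := by linarith
  have hmem (n : d → ℤ) : UnitAddTorus.mFourier n ∈ S := by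
    change Tendsto _ _ _
    by_cases hn : n = 0
    · subst hn
      simp only [UnitAddTorus.mFourier_zero, ContinuousMap.one_apply]
      refine tendsto_const_nhds.congr' ?_
      filter_upwards [eventually_gt_atTop 0] with T hT
      have : (T : ℂ) ≠ 0 := by exact_mod_cast hT.ne'
      simp [this]
    · have h0 : ∫ y, UnitAddTorus.mFourier n y ∂μ = 0 := by
        obtain ⟨i, hi⟩ := Function.ne_iff.1 hn
        simp only [UnitAddTorus.mFourier, ContinuousMap.coe_mk]
        rw [hμ, integral_fintype_prod_eq_prod (fun i (y : UnitAddCircle) ↦ (fourier (n i) y : ℂ))]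
        refine Finset.prod_eq_zero (Finset.mem_univ i) ?_
        exact integral_eq_zero_of_add_right_eq_neg (fourier_add_half_inv_index hi one_pos)
      rw [h0]
      have hc : 2 * π * ∑ i, n i * x i ≠ 0 :=
        mul_ne_zero (by positivity) (mt (hx n) hn)
      refine (tendsto_mean_cexp hc).congr fun T ↦ ?_
      congr 2
      ext t
      simp only [UnitAddTorus.mFourier, ContinuousMap.coe_mk, fourier_coe_apply]
      rw [← Complex.exp_sum]
      congr 1
      push_cast
      rw [Finset.mul_sum, Finset.sum_mul, Finset.sum_mul]
      refine Finset.sum_congr rfl fun i _ ↦ ?_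
      ring
  have htop : S = ⊤ := by
    rw [eq_top_iff, ← UnitAddTorus.span_mFourier_closure_eq_top]
    exact Submodule.topologicalClosure_minimal _ (Submodule.span_le.2 (range_subset_iff.2 hmem)) hclosed
  have : g ∈ S := htop ▸ Submodule.mem_top
  exact this

/-- Kronecker's theorem on a finite-dimensional torus. -/
theorem frequently_linear_flow_mem {d : Type*} [Fintype d] {x : d → ℝ}
    (hx : ∀ n : d → ℤ, ∑ i, n i * x i = 0 → n = 0) {U : Set (UnitAddTorus d)} (hU : IsOpen U)
    (hne : U.Nonempty) :
    ∃ᶠ t : ℝ in atTop, (fun i ↦ ((t * x i : ℝ) : UnitAddCircle)) ∈ U := by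
  intro hev
  obtain ⟨θ, hθ⟩ := hne
  obtain ⟨h, h0, h1, h01⟩ := exists_continuous_zero_one_of_isClosed hU.isClosed_compl
    (isClosed_singleton (x := θ)) (by simpa using hθ)
  set μ := Measure.pi fun _ : d ↦ (AddCircle.haarAddCircle : Measure UnitAddCircle)
  have hpos : 0 < ∫ y, h y ∂μ := by
    refine h.continuous.integral_pos_of_hasCompactSupport_nonneg_nonzero
      (HasCompactSupport.of_compactSpace _) (fun y ↦ (h01 y).1) (x := θ) ?_
    rw [h1 (mem_singleton θ)]; simp
  have hlim := tendsto_mean_linear_flow hx ((ContinuousMap.mk _ Complex.continuous_ofReal).comp h)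
  simp only [ContinuousMap.comp_apply, ContinuousMap.coe_mk, integral_complex_ofReal] at hlim
  have hcont : Continuous fun t : ℝ ↦ (fun i ↦ ((t * x i : ℝ) : UnitAddCircle) : UnitAddTorus d) :=
    continuous_pi fun i ↦ (AddCircle.continuous_mk' 1).comp (by fun_prop)
  obtain ⟨T₀, hT₀⟩ := eventually_atTop.1 hev
  have hzero : Tendsto (fun T : ℝ ↦ (T : ℂ)⁻¹ *
      ∫ t in (0 : ℝ)..T, (h (fun i ↦ ((t * x i : ℝ) : UnitAddCircle)) : ℂ)) atTop (𝓝 0) := by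
    have := ((Complex.continuous_ofReal.tendsto _).comp tendsto_inv_atTop_zero).mul_const
      (∫ t in (0 : ℝ)..T₀, (h (fun i ↦ ((t * x i : ℝ) : UnitAddCircle)) : ℂ))
    rw [Complex.ofReal_zero, zero_mul] at this
    refine this.congr' ?_
    filter_upwards [eventually_ge_atTop T₀] with T hT
    have hi (a b : ℝ) : IntervalIntegrable
        (fun t : ℝ ↦ (h (fun i ↦ ((t * x i : ℝ) : UnitAddCircle)) : ℂ)) volume a b :=
      ((Complex.continuous_ofReal.comp h.continuous).comp hcont).intervalIntegrable _ _
    rw [← intervalIntegral.integral_add_adjacent_intervals (hi 0 T₀) (hi T₀ T)]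
    have : ∫ t in T₀..T, (h (fun i ↦ ((t * x i : ℝ) : UnitAddCircle)) : ℂ) = 0 := by
      refine intervalIntegral.integral_zero_ae (Eventually.of_forall fun t ht ↦ ?_)
      rw [uIoc_of_le hT] at ht
      rw [h0 (hT₀ t ht.1.le)]; simp
    simp [this]
  have := tendsto_nhds_unique hlim hzero
  exact hpos.ne' (by exact_mod_cast this)

/-- **Kronecker's theorem**: the flow `t ↦ (exp (-i t x_i))_i` with linearly independent
frequencies accumulates at every point of the infinite-dimensional torus as `t → ∞`. -/
theorem mapClusterPt_cexp_of_linearIndependent {ι : Type*} {x : ι → ℝ} (hx : LinearIndependent ℤ x)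
    {θ : ι → ℂ} (hθ : ∀ i, ‖θ i‖ = 1) :
    MapClusterPt θ atTop fun (t : ℝ) i ↦ Complex.exp (-(t * x i : ℝ) * Complex.I) := by
  rw [mapClusterPt_iff_frequently]
  intro W hW
  obtain ⟨s, hs, V, hV, hVW⟩ : ∃ s : Set ι, s.Finite ∧ ∃ V : ι → Set ℂ,
      (∀ i, V i ∈ 𝓝 (θ i)) ∧ s.pi V ⊆ W := by
    rw [nhds_pi, Filter.mem_pi] at hW
    obtain ⟨s, hs, V, hV, h⟩ := hW
    exact ⟨s, hs, V, hV, h⟩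
  have := hs.fintype
  let U : Set (UnitAddTorus s) := {y | ∀ i : s, ((y i).toCircle : ℂ) ∈ interior (V i)}
  have hU : IsOpen U := by
    have : U = ⋂ i : s, (fun y : UnitAddTorus s ↦ ((y i).toCircle : ℂ)) ⁻¹' interior (V i) := by
      ext y; simp [U]
    rw [this]
    refine isOpen_iInter_of_finite fun i ↦ isOpen_interior.preimage ?_
    exact continuous_subtype_val.comp (AddCircle.continuous_toCircle.comp (continuous_apply i))
  have hne : U.Nonempty := by
    have (i : s) : ∃ y : UnitAddCircle, (y.toCircle : ℂ) = θ i := by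
      obtain ⟨y, hy⟩ := (AddCircle.homeomorphCircle (T := (1 : ℝ)) one_ne_zero).surjective
        ⟨θ i, mem_sphere_zero_iff_norm.2 (hθ i)⟩
      rw [AddCircle.homeomorphCircle_apply] at hy
      exact ⟨y, congrArg Subtype.val hy⟩
    choose y hy using this
    exact ⟨y, fun i ↦ by simpa only [hy] using mem_interior_iff_mem_nhds.2 (hV i)⟩
  have hind : ∀ n : s → ℤ, ∑ i, n i * (-x i / (2 * π)) = 0 → n = 0 := by
    intro n hn
    have := Fintype.linearIndependent_iff.1 (hx.comp ((↑) : s → ι) Subtype.val_injective) n ?_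
    · exact funext this
    · simp only [mul_div_assoc', ← Finset.sum_div, mul_neg, Finset.sum_neg_distrib] at hn
      have := (div_eq_zero_iff.1 hn).resolve_right (by positivity)
      simpa using this
  refine (frequently_linear_flow_mem hind hU hne).mono fun t ht ↦ hVW fun i hi ↦ ?_
  have := interior_subset (ht ⟨i, hi⟩)
  rw [AddCircle.toCircle_apply_mk, Circle.coe_exp] at this
  convert this using 2
  push_cast
  field_simp

/-- **Kronecker's theorem**, in terms of a filter along which the flow converges. -/
theorem exists_filter_tendsto_cexp_of_linearIndependent {ι : Type*} {x : ι → ℝ}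
    (hx : LinearIndependent ℤ x) {θ : ι → ℂ} (hθ : ∀ i, ‖θ i‖ = 1) :
    ∃ l : Filter ℝ, l.NeBot ∧ l ≤ atTop ∧
      ∀ i, Tendsto (fun t : ℝ ↦ Complex.exp (-(t * x i : ℝ) * Complex.I)) l (𝓝 (θ i)) := by
  have hcl := mapClusterPt_cexp_of_linearIndependent hx hθ
  set F : ℝ → ι → ℂ := fun t i ↦ Complex.exp (-(t * x i : ℝ) * Complex.I)
  refine ⟨atTop ⊓ comap F (𝓝 θ), NeBot.of_map (m := F) ?_, inf_le_left,
    fun i ↦ (tendsto_pi_nhds.1 (tendsto_comap (f := F)) i).mono_left inf_le_right⟩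
  rw [Filter.push_pull, inf_comm]
  exact hcl

/-- The Dirichlet series `∑ cₙ (n + α)^(-s)`. -/
noncomputable def shiftedDirichlet (α : ℝ) (c : ℕ → ℂ) (s : ℂ) : ℂ :=
  ∑' n : ℕ, c n * ((n + α : ℝ) : ℂ) ^ (-s)

theorem summable_nat_add_rpow_neg (α : ℝ) (hα : 0 < α) {σ : ℝ} (hσ : 1 < σ) :
    Summable fun n : ℕ ↦ ((n : ℝ) + α) ^ (-σ) := by
  refine ((Real.summable_one_div_nat_add_rpow α σ).2 hσ).congr fun n ↦ ?_
  have : 0 < (n : ℝ) + α := by positivity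
  rw [abs_of_pos this, Real.rpow_neg this.le, one_div]

theorem norm_ofReal_cpow_neg_le {x a b : ℝ} (hx : 0 < x) {s : ℂ} (ha : a ≤ s.re) (hb : s.re ≤ b) :
    ‖(x : ℂ) ^ (-s)‖ ≤ x ^ (-a) + x ^ (-b) := by
  rw [Complex.norm_cpow_eq_rpow_re_of_pos hx, Complex.neg_re]
  rcases le_total 1 x with h | h
  · have := Real.rpow_le_rpow_of_exponent_le h (neg_le_neg ha)
    have := Real.rpow_nonneg hx.le (-b)
    linarith
  · have := Real.rpow_le_rpow_of_exponent_ge hx h (neg_le_neg hb)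
    have := Real.rpow_nonneg hx.le (-a)
    linarith

theorem summable_shiftedDirichlet {α : ℝ} (hα : 0 < α) {c : ℕ → ℂ} (hc : ∀ n, ‖c n‖ ≤ 1) {s : ℂ}
    (hs : 1 < s.re) : Summable fun n : ℕ ↦ c n * ((n + α : ℝ) : ℂ) ^ (-s) := by
  refine .of_norm_bounded (summable_nat_add_rpow_neg α hα hs) fun n ↦ ?_
  rw [norm_mul, Complex.norm_cpow_eq_rpow_re_of_pos (by positivity), Complex.neg_re]
  exact mul_le_of_le_one_left (by positivity) (hc n)

theorem differentiableOn_shiftedDirichlet {α : ℝ} (hα : 0 < α) {c : ℕ → ℂ} (hc : ∀ n, ‖c n‖ ≤ 1) :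
    DifferentiableOn ℂ (shiftedDirichlet α c) {s | 1 < s.re} := by
  intro s hs
  obtain ⟨a, ha, has⟩ := exists_between (show 1 < s.re from hs)
  let U : Set ℂ := {z | a < z.re ∧ z.re < s.re + 1}
  have hU : IsOpen U := (isOpen_lt continuous_const Complex.continuous_re).inter
    (isOpen_lt Complex.continuous_re continuous_const)
  have hsU : s ∈ U := ⟨has, by simp⟩
  have : DifferentiableOn ℂ (shiftedDirichlet α c) U := by
    refine Complex.differentiableOn_tsum_of_summable_norm
      ((summable_nat_add_rpow_neg α hα ha).add
        (summable_nat_add_rpow_neg α hα (show 1 < s.re + 1 by linarith))) (fun n ↦ ?_) hU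
        fun n w hw ↦ ?_
    · have : ((n + α : ℝ) : ℂ) ≠ 0 := by exact_mod_cast (by positivity : (0 : ℝ) < n + α).ne'
      intro z _
      exact (((differentiableAt_id.neg).const_cpow (.inl this)).const_mul _).differentiableWithinAt
    · rw [norm_mul]
      exact (mul_le_of_le_one_left (norm_nonneg _) (hc n)).trans
        (norm_ofReal_cpow_neg_le (by positivity) hw.1.le hw.2.le)
  exact (this.differentiableAt (hU.mem_nhds hsU)).differentiableWithinAt

theorem hurwitzZeta_eq_shiftedDirichlet {α : ℝ} (hα : α ∈ Ioo (0 : ℝ) 1) {s : ℂ} (hs : 1 < s.re)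
    (t : ℝ) : hurwitzZeta (α : UnitAddCircle) (s + t * Complex.I) =
      shiftedDirichlet α (fun n ↦ ((n + α : ℝ) : ℂ) ^ (-(t * Complex.I))) s := by
  have h := hasSum_hurwitzZeta_of_one_lt_re ⟨hα.1.le, hα.2.le⟩
    (show 1 < (s + t * Complex.I).re by simpa using hs)
  rw [← h.tsum_eq, shiftedDirichlet]
  refine tsum_congr fun n ↦ ?_
  have : (n : ℂ) + α ≠ 0 := by
    have : (0 : ℝ) < n + α := by have := hα.1; positivity
    exact_mod_cast this.ne'
  push_cast
  rw [← Complex.cpow_add _ _ this, one_div, ← Complex.cpow_neg]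
  congr 1; ring

/-- If `‖f‖` at the centre of a disc is smaller than on the boundary circle, then `f` has a zero in
the disc. -/
theorem exists_zero_of_norm_center_lt {f : ℂ → ℂ} {z₀ : ℂ} {r m : ℝ} (hr : 0 < r)
    (hf : DifferentiableOn ℂ f (Metric.closedBall z₀ r)) (h0 : ‖f z₀‖ < m)
    (hm : ∀ z ∈ Metric.sphere z₀ r, m ≤ ‖f z‖) : ∃ z ∈ Metric.closedBall z₀ r, f z = 0 := by
  by_contra! hne
  have hm0 : 0 < m := (norm_nonneg _).trans_lt h0
  have hd : DiffContOnCl ℂ (fun z ↦ (f z)⁻¹) (Metric.ball z₀ r) := by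
    refine DifferentiableOn.diffContOnCl ?_
    rw [closure_ball _ hr.ne']
    exact hf.inv hne
  have := Complex.norm_le_of_forall_mem_frontier_norm_le Metric.isBounded_ball hd (C := m⁻¹)
    (fun z hz ↦ ?_) (subset_closure (Metric.mem_ball_self hr))
  · rw [norm_inv] at this
    have h1 : 0 < ‖f z₀‖ := norm_pos_iff.2 (hne _ (Metric.mem_closedBall_self hr.le))
    exact absurd ((inv_le_inv₀ h1 hm0).1 this) (not_le.2 h0)
  · rw [frontier_ball _ hr.ne'] at hz
    rw [norm_inv]
    exact (inv_le_inv₀ (hm0.trans_le (hm z hz)) hm0).2 (hm z hz)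

/-- If the vertical translates of `ζ(s, α)` approximate, coefficientwise, a Dirichlet series that
has a zero to the right of `1`, then so has `ζ(s, α)`, infinitely often. -/
theorem infinite_zeros_of_tendsto_coeff {α : ℝ} (hα : α ∈ Ioo (0 : ℝ) 1) {l : Filter ℝ} [l.NeBot]
    (hl : l ≤ atTop) {c : ℕ → ℂ}
    (hc : ∀ n : ℕ, Tendsto (fun t : ℝ ↦ ((n + α : ℝ) : ℂ) ^ (-(t * Complex.I))) l (𝓝 (c n)))
    {s₀ s₁ : ℂ} (hs₀ : 1 < s₀.re) (hs₁ : 1 < s₁.re) (h₀ : shiftedDirichlet α c s₀ = 0)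
    (h₁ : shiftedDirichlet α c s₁ ≠ 0) :
    {s : ℂ | 1 < s.re ∧ hurwitzZeta (α : UnitAddCircle) s = 0}.Infinite := by
  have hα0 := hα.1
  have hnorm (n : ℕ) (t : ℝ) : ‖((n + α : ℝ) : ℂ) ^ (-(t * Complex.I))‖ = 1 := by
    rw [Complex.norm_cpow_eq_rpow_re_of_pos (by positivity)]; simp
  have hcn (n : ℕ) : ‖c n‖ ≤ 1 :=
    le_of_tendsto (hc n).norm (Eventually.of_forall fun t ↦ (hnorm n t).le)
  have hopen : IsOpen {s : ℂ | 1 < s.re} := isOpen_lt continuous_const Complex.continuous_re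
  have hdiff := differentiableOn_shiftedDirichlet hα0 hcn
  have hana : AnalyticOnNhd ℂ (shiftedDirichlet α c) {s | 1 < s.re} := hdiff.analyticOnNhd hopen
  have hconn : IsPreconnected {s : ℂ | 1 < s.re} := (convex_halfSpace_re_gt 1).isPreconnected
  have hisol : ∀ᶠ z in 𝓝[≠] s₀, shiftedDirichlet α c z ≠ 0 := by
    refine (hana s₀ hs₀).eventually_eq_zero_or_eventually_ne_zero.resolve_left fun h ↦ h₁ ?_
    exact hana.eqOn_zero_of_preconnected_of_eventuallyEq_zero hconn hs₀ h hs₁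
  obtain ⟨R, hR, hRball⟩ := Metric.mem_nhds_iff.1
    (Filter.inter_mem (eventually_nhdsWithin_iff.1 hisol) (hopen.mem_nhds hs₀))
  set r := R / 2
  have hr : 0 < r := by positivity
  have hball : Metric.closedBall s₀ r ⊆ Metric.ball s₀ R :=
    Metric.closedBall_subset_ball (by simp only [r]; linarith)
  have hre : Metric.closedBall s₀ r ⊆ {s | 1 < s.re} := fun z hz ↦ (hRball (hball hz)).2
  have hsph : ∀ z ∈ Metric.sphere s₀ r, shiftedDirichlet α c z ≠ 0 := fun z hz ↦
    (hRball (hball (Metric.sphere_subset_closedBall hz))).1 (Metric.ne_of_mem_sphere hz hr.ne')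
  obtain ⟨m, hm, hmle⟩ : ∃ m > 0, ∀ z ∈ Metric.sphere s₀ r, m ≤ ‖shiftedDirichlet α c z‖ := by
    obtain ⟨z, hz, hzmin⟩ := (isCompact_sphere s₀ r).exists_isMinOn
      (NormedSpace.sphere_nonempty.2 hr.le)
      (f := fun z ↦ ‖shiftedDirichlet α c z‖)
      ((hdiff.continuousOn.mono (Metric.sphere_subset_closedBall.trans hre)).norm)
    exact ⟨_, norm_pos_iff.2 (hsph z hz), fun w hw ↦ hzmin hw⟩
  have hrebd : ∀ z ∈ Metric.closedBall s₀ r, s₀.re - r ≤ z.re ∧ z.re ≤ s₀.re + r := by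
    intro z hz
    have := (Complex.abs_re_le_norm (z - s₀)).trans (by simpa [dist_eq_norm] using hz)
    rw [Complex.sub_re, abs_le] at this
    constructor <;> linarith
  have ha : 1 < s₀.re - r := by
    have : s₀ - r ∈ Metric.closedBall s₀ r := by simp [abs_of_pos hr]
    simpa using hre this
  set u : ℕ → ℝ := fun n ↦ ((n : ℝ) + α) ^ (-(s₀.re - r)) + ((n : ℝ) + α) ^ (-(s₀.re + r))
  have hu : Summable u := (summable_nat_add_rpow_neg α hα0 ha).add
    (summable_nat_add_rpow_neg α hα0 (by linarith))
  have hu0 (n : ℕ) : 0 ≤ u n := by positivity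
  have hdc (t : ℝ) (n : ℕ) : ‖((n + α : ℝ) : ℂ) ^ (-(t * Complex.I)) - c n‖ ≤ 2 :=
    (norm_sub_le _ _).trans (by linarith [hnorm n t, hcn n])
  have hbound (t : ℝ) (n : ℕ) : u n * ‖((n + α : ℝ) : ℂ) ^ (-(t * Complex.I)) - c n‖ ≤ u n * 2 :=
    mul_le_mul_of_nonneg_left (hdc t n) (hu0 n)
  have hE : Tendsto (fun t : ℝ ↦ ∑' n, u n * ‖((n + α : ℝ) : ℂ) ^ (-(t * Complex.I)) - c n‖) l
      (𝓝 0) := by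
    have := tendsto_tsum_of_dominated_convergence (𝓕 := l) (hu.mul_right 2)
      (f := fun t n ↦ u n * ‖((n + α : ℝ) : ℂ) ^ (-(t * Complex.I)) - c n‖) (g := fun _ ↦ 0)
      (fun n ↦ ?_) (Eventually.of_forall fun t n ↦ ?_)
    · simpa using this
    · simpa using ((hc n).sub_const (c n)).norm.const_mul (u n)
    · rw [Real.norm_of_nonneg (by positivity)]
      exact hbound t n
  have hclose (t : ℝ) (z : ℂ) (hz : z ∈ Metric.closedBall s₀ r) :
      ‖hurwitzZeta (α : UnitAddCircle) (z + t * Complex.I) - shiftedDirichlet α c z‖ ≤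
        ∑' n, u n * ‖((n + α : ℝ) : ℂ) ^ (-(t * Complex.I)) - c n‖ := by
    rw [hurwitzZeta_eq_shiftedDirichlet hα (hre hz), shiftedDirichlet, shiftedDirichlet,
      ← (summable_shiftedDirichlet hα0 (fun n ↦ (hnorm n t).le) (hre hz)).tsum_sub
        (summable_shiftedDirichlet hα0 hcn (hre hz))]
    refine tsum_of_norm_bounded (Summable.hasSum (.of_nonneg_of_le (fun n ↦ by positivity) (hbound t)
      (hu.mul_right 2))) fun n ↦ ?_
    rw [← sub_mul, norm_mul, mul_comm]
    gcongr
    exact norm_ofReal_cpow_neg_le (by positivity) (hrebd z hz).1 (hrebd z hz).2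
  have hzero : ∀ᶠ t : ℝ in l, ∃ z ∈ Metric.closedBall s₀ r,
      hurwitzZeta (α : UnitAddCircle) (z + t * Complex.I) = 0 := by
    filter_upwards [hE.eventually_lt_const (show 0 < m / 2 by positivity)] with t ht
    refine exists_zero_of_norm_center_lt (m := m / 2) hr
      (f := fun z ↦ hurwitzZeta (α : UnitAddCircle) (z + t * Complex.I)) ?_ ?_ ?_
    · intro z hz
      have hne : z + t * Complex.I ≠ 1 := fun h ↦ by
        have h1 : 1 < z.re := hre hz
        have := congrArg Complex.re h
        simp at this
        linarith
      exact ((differentiableAt_hurwitzZeta _ hne).comp z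
        (differentiableAt_id.add_const _)).differentiableWithinAt
    · have := (hclose t s₀ (Metric.mem_closedBall_self hr.le)).trans_lt ht
      rwa [h₀, sub_zero] at this
    · intro z hz
      have h1 := (hclose t z (Metric.sphere_subset_closedBall hz)).trans_lt ht
      have h2 := hmle z hz
      rw [norm_sub_rev] at h1
      have := norm_sub_norm_le (shiftedDirichlet α c z)
        (hurwitzZeta (α : UnitAddCircle) (z + t * Complex.I))
      linarith
  intro hfin
  obtain ⟨B, hB⟩ := (hfin.image Complex.im).bddAbove
  obtain ⟨t, ⟨z, hz, hz0⟩, ht⟩ := (hzero.and (hl (eventually_gt_atTop (B - s₀.im + r)))).exists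
  have h1 : z.im + t ≤ B := by
    refine hB ⟨z + t * Complex.I, ⟨?_, hz0⟩, by simp⟩
    have : 1 < z.re := hre hz
    simpa using this
  have := (Complex.abs_im_le_norm (z - s₀)).trans (by simpa [dist_eq_norm] using hz)
  rw [Complex.sub_im, abs_le] at this
  linarith

/-- A version of `infinite_zeros_of_tendsto_coeff` where the limiting Dirichlet series is real up to
a constant factor and changes sign on the real axis. -/
theorem infinite_zeros_of_sign_change {α : ℝ} (hα : α ∈ Ioo (0 : ℝ) 1) {l : Filter ℝ} [l.NeBot]
    (hl : l ≤ atTop) {w : ℂ} (hw : w ≠ 0) {ρ : ℕ → ℝ} (hρ : ∀ n, |ρ n| ≤ 1)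
    (hc : ∀ n : ℕ, Tendsto (fun t : ℝ ↦ ((n + α : ℝ) : ℂ) ^ (-(t * Complex.I))) l (𝓝 (w * ρ n)))
    {σ₁ σ₂ : ℝ} (hσ₁ : 1 < σ₁) (hσ₂ : 1 < σ₂) (h₁ : ∑' n : ℕ, ρ n * ((n : ℝ) + α) ^ (-σ₁) < 0)
    (h₂ : 0 < ∑' n : ℕ, ρ n * ((n : ℝ) + α) ^ (-σ₂)) :
    {s : ℂ | 1 < s.re ∧ hurwitzZeta (α : UnitAddCircle) s = 0}.Infinite := by
  have hα0 := hα.1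
  have hreal (σ : ℝ) : shiftedDirichlet α (fun n ↦ ρ n) σ =
      ((∑' n : ℕ, ρ n * ((n : ℝ) + α) ^ (-σ) : ℝ) : ℂ) := by
    rw [shiftedDirichlet, Complex.ofReal_tsum]
    refine tsum_congr fun n ↦ ?_
    rw [Complex.ofReal_mul, Complex.ofReal_cpow (by positivity), Complex.ofReal_neg]
  have hmul (s : ℂ) : shiftedDirichlet α (fun n ↦ w * ρ n) s =
      w * shiftedDirichlet α (fun n ↦ ρ n) s := by
    simp only [shiftedDirichlet, mul_assoc, tsum_mul_left]
  have hcont : ContinuousOn (fun σ : ℝ ↦ ∑' n : ℕ, ρ n * ((n : ℝ) + α) ^ (-σ)) (Ioi 1) := by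
    have h := (differentiableOn_shiftedDirichlet hα0 (c := fun n ↦ ρ n)
      (by simpa using hρ)).continuousOn
    have := Complex.continuous_re.comp_continuousOn (h.comp
      (Complex.continuous_ofReal.continuousOn (s := Ioi 1)) (fun σ hσ ↦ by simpa using hσ))
    refine this.congr fun σ _ ↦ ?_
    simp [hreal]
  obtain ⟨σ, hσ, h0⟩ := isPreconnected_Ioi.intermediate_value hσ₁ hσ₂ hcont ⟨h₁.le, h₂.le⟩
  refine infinite_zeros_of_tendsto_coeff hα hl hc (s₀ := σ) (s₁ := σ₁) (by simpa using hσ)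
    (by simpa using hσ₁) ?_ ?_
  · simp only at h0
    rw [hmul, hreal, h0]; simp
  · rw [hmul, hreal]
    exact mul_ne_zero hw (by exact_mod_cast h₁.ne)

/-- If `∑ cᵢ / xᵢ` diverges then `∑ cᵢ xᵢ^(-σ)` tends to infinity as `σ → 1⁺`. -/
theorem tendsto_tsum_mul_rpow_neg_atTop {ι : Type*} {x c : ι → ℝ} (hx : ∀ i, 0 < x i)
    (hc : ∀ i, 0 ≤ c i) (hsum : ∀ σ : ℝ, 1 < σ → Summable fun i ↦ c i * x i ^ (-σ))
    (hdiv : ¬ Summable fun i ↦ c i * x i ^ (-1 : ℝ)) :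
    Tendsto (fun σ : ℝ ↦ ∑' i, c i * x i ^ (-σ)) (𝓝[>] 1) atTop := by
  have h0 (σ : ℝ) (i : ι) : 0 ≤ c i * x i ^ (-σ) :=
    mul_nonneg (hc i) (Real.rpow_nonneg (hx i).le _)
  rw [tendsto_atTop]
  intro B
  obtain ⟨s, hs⟩ : ∃ s : Finset ι, B < ∑ i ∈ s, c i * x i ^ (-1 : ℝ) := by
    by_contra! h
    exact hdiv (summable_of_sum_le (h0 1) h)
  have hcont : Continuous fun σ : ℝ ↦ ∑ i ∈ s, c i * x i ^ (-σ) :=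
    continuous_finsetSum _ fun i _ ↦ continuous_const.mul <|
      (Real.continuous_const_rpow (hx i).ne').comp continuous_neg
  filter_upwards [nhdsWithin_le_nhds (hcont.continuousAt.eventually (lt_mem_nhds hs)),
    self_mem_nhdsWithin] with σ hσ hσ1
  exact hσ.le.trans ((hsum σ hσ1).sum_le_tsum s fun i _ ↦ h0 σ i)

theorem ofReal_cpow_neg_mul_I {x : ℝ} (hx : 0 < x) (t : ℝ) :
    (x : ℂ) ^ (-(t * Complex.I)) = Complex.exp (-(t * Real.log x : ℝ) * Complex.I) := by
  rw [Complex.cpow_def_of_ne_zero (by exact_mod_cast hx.ne'), ← Complex.ofReal_log hx.le]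
  congr 1
  push_cast
  ring

/-- For transcendental `α` the numbers `log (n + α)` are linearly independent over `ℤ`. -/
theorem linearIndependent_log_nat_add {α : ℝ} (hα : 0 < α) (htr : Transcendental ℚ α) :
    LinearIndependent ℤ fun n : ℕ ↦ Real.log (n + α) := by
  rw [linearIndependent_iff']
  have key (s : Finset ℕ) (g : ℕ → ℤ) (hg : ∑ i ∈ s, g i • Real.log (i + α) = 0) :
      ∀ i ∈ s, g i ≤ 0 := by
    intro i hi
    by_contra! hpos
    let P (g : ℕ → ℤ) : Polynomial ℚ :=
      ∏ j ∈ s, (Polynomial.X + Polynomial.C (j : ℚ)) ^ (g j).toNat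
    have hP (g : ℕ → ℤ) : Polynomial.aeval α (P g) = ∏ j ∈ s, ((j : ℝ) + α) ^ (g j).toNat := by
      simp [P, map_prod, add_comm]
    have hPpos (g : ℕ → ℤ) : 0 < Polynomial.aeval α (P g) := by
      rw [hP]; exact Finset.prod_pos fun j _ ↦ by positivity
    have hPlog (g : ℕ → ℤ) : Real.log (Polynomial.aeval α (P g)) =
        ∑ j ∈ s, ((g j).toNat : ℝ) * Real.log (j + α) := by
      rw [hP, Real.log_prod fun j _ ↦ by positivity]
      simp [Real.log_pow]
    have heq : P g = P (-g) := by
      refine transcendental_iff_injective.1 htr (Real.log_injOn_pos (hPpos _) (hPpos _) ?_)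
      rw [hPlog, hPlog, ← sub_eq_zero, ← Finset.sum_sub_distrib, ← hg]
      refine Finset.sum_congr rfl fun j _ ↦ ?_
      rw [← sub_mul, zsmul_eq_mul]
      congr 1
      have : ((g j).toNat : ℤ) - (((-g) j).toNat : ℤ) = g j := by
        rw [Pi.neg_apply]; omega
      exact_mod_cast this
    have h1 : (P g).eval (-(i : ℚ)) = 0 := by
      rw [Polynomial.eval_prod]
      refine Finset.prod_eq_zero hi ?_
      have : (g i).toNat ≠ 0 := by omega
      simp [this]
    have h2 : (P (-g)).eval (-(i : ℚ)) ≠ 0 := by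
      rw [Polynomial.eval_prod]
      refine Finset.prod_ne_zero_iff.2 fun j _ ↦ ?_
      by_cases hj : j = i
      · subst hj
        simp [hpos.le]
      · have : -(i : ℚ) + j ≠ 0 := fun h ↦ hj (by
          have : (j : ℚ) = i := by linarith
          exact_mod_cast this)
        simp [this]
    exact h2 (heq ▸ h1)
  intro s g hg i hi
  have h1 := key s g hg i hi
  have h2 := key s (-g) (by simpa using hg) i hi
  rw [Pi.neg_apply] at h2
  omega

theorem not_summable_nat_add_rpow_neg_one (α : ℝ) (hα : 0 < α) :
    ¬ Summable fun n : ℕ ↦ ((n : ℝ) + α) ^ (-1 : ℝ) := by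
  intro h
  refine absurd ((Real.summable_one_div_nat_add_rpow α 1).1 (h.congr fun n ↦ ?_)) (lt_irrefl _)
  have : 0 < (n : ℝ) + α := by positivity
  rw [abs_of_pos this, Real.rpow_neg this.le, one_div]

theorem infinite_zeros_of_transcendental {α : ℝ} (hα : α ∈ Ioo (0 : ℝ) 1)
    (htr : Transcendental ℚ α) :
    {s : ℂ | 1 < s.re ∧ hurwitzZeta (α : UnitAddCircle) s = 0}.Infinite := by
  have hα0 := hα.1
  have hsum {σ : ℝ} (hσ : 1 < σ) := summable_nat_add_rpow_neg α hα0 hσ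
  set S : ℝ → ℝ := fun σ ↦ ∑' n : ℕ, ((n : ℝ) + α) ^ (-σ) with hS
  have hS2 : 0 < S 2 := (hsum one_lt_two).tsum_pos (fun n ↦ by positivity) 0 (by positivity)
  obtain ⟨N, hN⟩ : ∃ N : ℕ, S 2 / 2 < ∑ n ∈ Finset.range N, ((n : ℝ) + α) ^ (-(2 : ℝ)) :=
    (((hsum one_lt_two).hasSum.tendsto_sum_nat).eventually_const_lt (half_lt_self hS2)).exists
  let ρ : ℕ → ℝ := fun n ↦ if n < N then 1 else -1
  have hρ (n : ℕ) : |ρ n| = 1 := by simp only [ρ]; split_ifs <;> simp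
  have hG {σ : ℝ} (hσ : 1 < σ) : ∑' n : ℕ, ρ n * ((n : ℝ) + α) ^ (-σ) =
      2 * ∑ n ∈ Finset.range N, ((n : ℝ) + α) ^ (-σ) - S σ := by
    have h1 : HasSum (fun n : ℕ ↦ if n < N then 2 * ((n : ℝ) + α) ^ (-σ) else 0)
        (∑ n ∈ Finset.range N, if n < N then 2 * ((n : ℝ) + α) ^ (-σ) else 0) :=
      hasSum_sum_of_ne_finset_zero fun n hn ↦ by simp_all
    rw [Finset.sum_congr rfl (g := fun n : ℕ ↦ 2 * ((n : ℝ) + α) ^ (-σ))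
      (fun n hn ↦ if_pos (Finset.mem_range.1 hn)), ← Finset.mul_sum] at h1
    refine HasSum.tsum_eq ((h1.sub (hsum hσ).hasSum).congr_fun ?_)
    intro n
    simp only [ρ]
    split_ifs <;> ring
  have hneg : ∀ᶠ σ in 𝓝[>] (1 : ℝ), ∑' n : ℕ, ρ n * ((n : ℝ) + α) ^ (-σ) < 0 := by
    have hlim : Tendsto S (𝓝[>] 1) atTop := by
      simpa using tendsto_tsum_mul_rpow_neg_atTop (x := fun n : ℕ ↦ (n : ℝ) + α) (c := fun _ ↦ 1)
        (fun n ↦ by positivity) (fun _ ↦ zero_le_one) (fun σ hσ ↦ by simpa using hsum hσ)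
        (by simpa using not_summable_nat_add_rpow_neg_one α hα0)
    have hcont : Continuous fun σ : ℝ ↦ 2 * ∑ n ∈ Finset.range N, ((n : ℝ) + α) ^ (-σ) :=
      continuous_const.mul (continuous_finsetSum _ fun n _ ↦
        (Real.continuous_const_rpow (by positivity : (n : ℝ) + α ≠ 0)).comp continuous_neg)
    have h1 := (hcont.tendsto 1).mono_left (nhdsWithin_le_nhds (s := Ioi (1 : ℝ)))
    filter_upwards [h1.eventually_lt_const (lt_add_one _), hlim.eventually_ge_atTop
      (2 * ∑ n ∈ Finset.range N, ((n : ℝ) + α) ^ (-1 : ℝ) + 1), self_mem_nhdsWithin]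
      with σ h2 h3 h4
    rw [hG h4]
    linarith
  obtain ⟨σ₁, h₁, hσ₁⟩ := (hneg.and self_mem_nhdsWithin).exists
  obtain ⟨l, hl, hle, hlim⟩ := exists_filter_tendsto_cexp_of_linearIndependent
    (linearIndependent_log_nat_add hα0 htr) (θ := fun n ↦ (ρ n : ℂ))
    (fun n ↦ by rw [Complex.norm_real, Real.norm_eq_abs, hρ])
  refine infinite_zeros_of_sign_change hα hle one_ne_zero (fun n ↦ (hρ n).le)
    (fun n ↦ ?_) hσ₁ one_lt_two h₁ ?_
  · simpa only [one_mul, ofReal_cpow_neg_mul_I (show 0 < (n : ℝ) + α by positivity)] using hlim n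
  · rw [hG one_lt_two]
    linarith

/-- The series `∑ cₚ p^(-σ)` over the primes. -/
noncomputable def primeSum (c : Nat.Primes → ℂ) (σ : ℝ) : ℂ :=
  ∑' p : Nat.Primes, c p * ((p : ℝ) ^ (-σ) : ℝ)

/-- The logarithm `-∑ log (1 - cₚ p^(-σ))` of an Euler product. -/
noncomputable def primeLogSum (c : Nat.Primes → ℂ) (σ : ℝ) : ℂ :=
  ∑' p : Nat.Primes, -Complex.log (1 - c p * ((p : ℝ) ^ (-σ) : ℝ))

theorem summable_primes_rpow_neg {σ : ℝ} (hσ : 1 < σ) :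
    Summable fun p : Nat.Primes ↦ (p : ℝ) ^ (-σ) :=
  Nat.Primes.summable_rpow.2 (by linarith)

theorem norm_mul_prime_rpow_le {c : Nat.Primes → ℂ} (hc : ∀ p, ‖c p‖ ≤ 1) (p : Nat.Primes) (σ : ℝ) :
    ‖c p * ((p : ℝ) ^ (-σ) : ℝ)‖ ≤ (p : ℝ) ^ (-σ) := by
  have := Real.rpow_nonneg (Nat.cast_nonneg (p : ℕ) : (0 : ℝ) ≤ (p : ℕ)) (-σ)
  rw [norm_mul, Complex.norm_real, Real.norm_of_nonneg this]
  exact mul_le_of_le_one_left this (hc p)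

theorem prime_rpow_neg_le_rpow_neg (p : Nat.Primes) {σ τ : ℝ} (h : τ ≤ σ) :
    (p : ℝ) ^ (-σ) ≤ (p : ℝ) ^ (-τ) :=
  Real.rpow_le_rpow_of_exponent_le (by exact_mod_cast p.2.one_lt.le) (by linarith)

theorem prime_rpow_neg_le_half (p : Nat.Primes) {σ : ℝ} (hσ : 1 ≤ σ) :
    (p : ℝ) ^ (-σ) ≤ 1 / 2 := by
  refine (prime_rpow_neg_le_rpow_neg p hσ).trans ?_
  rw [Real.rpow_neg_one, one_div]
  exact inv_anti₀ two_pos (by exact_mod_cast p.2.two_le)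

theorem summable_primeSum {c : Nat.Primes → ℂ} (hc : ∀ p, ‖c p‖ ≤ 1) {σ : ℝ} (hσ : 1 < σ) :
    Summable fun p : Nat.Primes ↦ c p * ((p : ℝ) ^ (-σ) : ℝ) :=
  .of_norm_bounded (summable_primes_rpow_neg hσ) fun p ↦ norm_mul_prime_rpow_le hc p σ

theorem norm_neg_log_one_sub_le {c : Nat.Primes → ℂ} (hc : ∀ p, ‖c p‖ ≤ 1) (p : Nat.Primes) {σ τ : ℝ}
    (hσ : 1 ≤ τ) (hτσ : τ ≤ σ) :
    ‖-Complex.log (1 - c p * ((p : ℝ) ^ (-σ) : ℝ))‖ ≤ 3 / 2 * (p : ℝ) ^ (-τ) := by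
  have h := norm_mul_prime_rpow_le hc p σ
  rw [norm_neg, sub_eq_add_neg]
  refine (Complex.norm_log_one_add_half_le_self ?_).trans ?_
  · rw [norm_neg]; exact h.trans (prime_rpow_neg_le_half p (hσ.trans hτσ))
  · rw [norm_neg]
    gcongr
    exact h.trans (prime_rpow_neg_le_rpow_neg p hτσ)

theorem summable_primeLogSum {c : Nat.Primes → ℂ} (hc : ∀ p, ‖c p‖ ≤ 1) {σ : ℝ} (hσ : 1 < σ) :
    Summable fun p : Nat.Primes ↦ -Complex.log (1 - c p * ((p : ℝ) ^ (-σ) : ℝ)) :=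
  .of_norm_bounded ((summable_primes_rpow_neg hσ).mul_left (3 / 2)) fun p ↦
    norm_neg_log_one_sub_le hc p hσ.le le_rfl

theorem continuousOn_primeLogSum {c : Nat.Primes → ℂ} (hc : ∀ p, ‖c p‖ ≤ 1) :
    ContinuousOn (primeLogSum c) (Ioi 1) := by
  intro σ hσ
  obtain ⟨τ, hτ, hτσ⟩ := exists_between (show 1 < σ from hσ)
  have : ContinuousOn (primeLogSum c) (Ici τ) := by
    refine continuousOn_tsum (fun p ↦ ?_) ((summable_primes_rpow_neg hτ).mul_left (3 / 2))
      fun p x hx ↦ norm_neg_log_one_sub_le hc p hτ.le hx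
    have hp : ((p : ℕ) : ℝ) ≠ 0 := by exact_mod_cast p.2.ne_zero
    refine (ContinuousOn.clog ?_ fun x hx ↦ ?_).neg
    · exact Continuous.continuousOn (continuous_const.sub (continuous_const.mul
        (Complex.continuous_ofReal.comp ((Real.continuous_const_rpow hp).comp continuous_neg))))
    · rw [sub_eq_add_neg]
      refine Complex.mem_slitPlane_of_norm_lt_one ?_
      rw [norm_neg]
      have := prime_rpow_neg_le_half p (hτ.le.trans hx)
      linarith [norm_mul_prime_rpow_le hc p x]
  exact (this.continuousAt (Ici_mem_nhds hτσ)).continuousWithinAt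

theorem primeLogSum_sub_primeSum_isBigO {c : Nat.Primes → ℂ} (hc : ∀ p, ‖c p‖ ≤ 1) :
    (fun σ ↦ primeLogSum c σ - primeSum c σ) =O[𝓝[>] 1] (fun _ ↦ (1 : ℝ)) := by
  refine Asymptotics.IsBigO.of_bound (∑' p : Nat.Primes, (p : ℝ) ^ (-2 : ℝ)) ?_
  filter_upwards [self_mem_nhdsWithin] with σ hσ
  rw [norm_one, mul_one, primeLogSum, primeSum,
    ← (summable_primeLogSum hc hσ).tsum_sub (summable_primeSum hc hσ)]
  refine tsum_of_norm_bounded (summable_primes_rpow_neg one_lt_two).hasSum fun p ↦ ?_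
  set z := c p * ((p : ℝ) ^ (-σ) : ℝ)
  have h1 : ‖z‖ ≤ (p : ℝ) ^ (-1 : ℝ) := (norm_mul_prime_rpow_le hc p σ).trans
    (prime_rpow_neg_le_rpow_neg p (le_of_lt hσ))
  have h2 : ‖z‖ ≤ 1 / 2 := h1.trans (prime_rpow_neg_le_half p le_rfl)
  have h3 := Complex.norm_log_one_add_sub_self_le (z := -z) (by rw [norm_neg]; linarith)
  rw [norm_neg] at h3
  have h4 : (1 - ‖z‖)⁻¹ ≤ 2 := by
    rw [inv_le_comm₀ (by linarith) two_pos]; linarith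
  calc ‖-Complex.log (1 - z) - z‖ = ‖Complex.log (1 + -z) - -z‖ := by
        rw [← norm_neg]; congr 1; ring_nf
    _ ≤ ‖z‖ ^ 2 * (1 - ‖z‖)⁻¹ / 2 := h3
    _ ≤ ‖z‖ ^ 2 * 2 / 2 := by gcongr
    _ = ‖z‖ ^ 2 := by ring
    _ ≤ ((p : ℝ) ^ (-1 : ℝ)) ^ 2 := by gcongr
    _ = (p : ℝ) ^ (-2 : ℝ) := by
      rw [← Real.rpow_natCast, ← Real.rpow_mul (Nat.cast_nonneg _)]; norm_num

theorem primeSum_eq_mul_add_mul {c c₁ c₂ : Nat.Primes → ℂ} (h₁ : ∀ p, ‖c₁ p‖ ≤ 1)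
    (h₂ : ∀ p, ‖c₂ p‖ ≤ 1) {u v : ℂ} (h : ∀ p, c p = u * c₁ p + v * c₂ p) {σ : ℝ} (hσ : 1 < σ) :
    primeSum c σ = u * primeSum c₁ σ + v * primeSum c₂ σ := by
  rw [primeSum, primeSum, primeSum, ← tsum_mul_left, ← tsum_mul_left,
    ← ((summable_primeSum h₁ hσ).mul_left u).tsum_add ((summable_primeSum h₂ hσ).mul_left v)]
  refine tsum_congr fun p ↦ ?_
  rw [h]; ring

/-- The logarithm of `L(σ, χ)` stays bounded as `σ → 1⁺` if `χ` is nontrivial. -/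
theorem primeLogSum_dirichletCharacter_isBigO {q : ℕ} [NeZero q] {χ : DirichletCharacter ℂ q}
    (hχ : χ ≠ 1) :
    primeLogSum (fun p ↦ χ (p : ℕ)) =O[𝓝[>] 1] (fun _ ↦ (1 : ℝ)) := by
  have hc (p : Nat.Primes) : ‖χ (p : ℕ)‖ ≤ 1 := χ.norm_le_one _
  have hL1 := DirichletCharacter.LFunction_apply_one_ne_zero hχ
  have hexp {σ : ℝ} (hσ : 1 < σ) : Complex.exp (primeLogSum (fun p ↦ χ (p : ℕ)) σ) =
      χ.LFunction σ := by
    have hs : 1 < (σ : ℂ).re := by simpa using hσ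
    rw [χ.LFunction_eq_LSeries hs, ← χ.LSeries_eulerProduct_exp_log hs, primeLogSum]
    congr 1
    refine tsum_congr fun p ↦ ?_
    rw [Complex.ofReal_cpow (Nat.cast_nonneg _)]; push_cast; rfl
  have hcontL : Continuous fun σ : ℝ ↦ χ.LFunction σ / χ.LFunction 1 :=
    ((χ.differentiable_LFunction hχ).continuous.comp Complex.continuous_ofReal).div_const _
  have hlim : Tendsto (fun σ : ℝ ↦ χ.LFunction σ / χ.LFunction 1) (𝓝 1) (𝓝 1) := by
    have := hcontL.tendsto 1
    rwa [Complex.ofReal_one, div_self hL1] at this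
  obtain ⟨δ, hδ, hball⟩ := Metric.eventually_nhds_iff.1
    (hlim.eventually (Complex.isOpen_slitPlane.mem_nhds Complex.one_mem_slitPlane))
  have hslit : ∀ σ ∈ Ioo 1 (1 + δ), χ.LFunction (σ : ℝ) / χ.LFunction 1 ∈ Complex.slitPlane := by
    intro σ hσ
    refine hball ?_
    rw [Real.dist_eq, abs_of_pos (by linarith [hσ.1])]
    linarith [hσ.2]
  set D : ℝ → ℂ := fun σ ↦ primeLogSum (fun p ↦ χ (p : ℕ)) σ -
    Complex.log (χ.LFunction σ / χ.LFunction 1)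
  have hD : ContinuousOn D (Ioo 1 (1 + δ)) :=
    ((continuousOn_primeLogSum hc).mono fun σ hσ ↦ hσ.1).sub (hcontL.continuousOn.clog hslit)
  have hexpD : ∀ σ ∈ Ioo 1 (1 + δ), Complex.exp (D σ) = χ.LFunction 1 := by
    intro σ hσ
    have hne := Complex.slitPlane_ne_zero (hslit σ hσ)
    simp only [D]
    rw [Complex.exp_sub, hexp hσ.1, Complex.exp_log hne]
    have := (div_ne_zero_iff.1 hne).1
    field_simp
  have hmid : 1 + δ / 2 ∈ Ioo 1 (1 + δ) := ⟨by linarith, by linarith⟩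
  have hconst : ∀ σ ∈ Ioo 1 (1 + δ), D σ = D (1 + δ / 2) := fun σ hσ ↦
    Complex.isCoveringMap_exp.isSeparatedMap.constOn_of_comp
      Complex.isCoveringMap_exp.isLocalHomeomorph.isLocallyInjective isPreconnected_Ioo hD
      (fun a ha b hb ↦ Subtype.ext ((hexpD a ha).trans (hexpD b hb).symm)) hσ hmid
  have hlog : Tendsto (fun σ : ℝ ↦ D (1 + δ / 2) + Complex.log (χ.LFunction σ / χ.LFunction 1))
      (𝓝[>] 1) (𝓝 (D (1 + δ / 2) + Complex.log 1)) :=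
    tendsto_const_nhds.add ((hlim.mono_left nhdsWithin_le_nhds).clog Complex.one_mem_slitPlane)
  refine (hlog.congr' ?_).isBigO_one ℝ
  filter_upwards [Ioo_mem_nhdsGT (show (1 : ℝ) < 1 + δ by linarith)] with σ hσ
  rw [← hconst σ hσ]
  simp only [D]
  ring

theorem primeSum_dirichletCharacter_isBigO {q : ℕ} [NeZero q] {χ : DirichletCharacter ℂ q}
    (hχ : χ ≠ 1) :
    primeSum (fun p ↦ χ (p : ℕ)) =O[𝓝[>] 1] (fun _ ↦ (1 : ℝ)) := by
  have := (primeLogSum_dirichletCharacter_isBigO hχ).sub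
    (primeLogSum_sub_primeSum_isBigO (c := fun p ↦ χ (p : ℕ)) fun p ↦ χ.norm_le_one _)
  simpa using this

/-- For the trivial character modulo `q` the prime sum is real and tends to infinity. -/
theorem exists_primeSum_one_eq_ofReal (q : ℕ) [NeZero q] :
    ∃ P : ℝ → ℝ, Tendsto P (𝓝[>] 1) atTop ∧
      ∀ σ, primeSum (fun p ↦ (1 : DirichletCharacter ℂ q) (p : ℕ)) σ = P σ := by
  classical
  let c : Nat.Primes → ℝ := fun p ↦ if IsUnit ((p : ℕ) : ZMod q) then 1 else 0
  have hc (p : Nat.Primes) : (1 : DirichletCharacter ℂ q) (p : ℕ) = c p := by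
    simp only [c]
    split_ifs with h
    · simp [MulChar.one_apply h]
    · simp [MulChar.map_nonunit _ h]
  have hc0 (p : Nat.Primes) : 0 ≤ c p := by simp only [c]; split_ifs <;> simp
  have hc1 (p : Nat.Primes) : c p ≤ 1 := by simp only [c]; split_ifs <;> simp
  have hp0 (p : Nat.Primes) : (0 : ℝ) < (p : ℕ) := by exact_mod_cast p.2.pos
  refine ⟨fun σ ↦ ∑' p : Nat.Primes, c p * (p : ℝ) ^ (-σ),
    tendsto_tsum_mul_rpow_neg_atTop hp0 hc0 (fun σ hσ ↦ ?_) fun h ↦ ?_, fun σ ↦ ?_⟩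
  · exact .of_nonneg_of_le (fun p ↦ mul_nonneg (hc0 p) (Real.rpow_nonneg (hp0 p).le _))
      (fun p ↦ mul_le_of_le_one_left (Real.rpow_nonneg (hp0 p).le _) (hc1 p))
      (summable_primes_rpow_neg hσ)
  · have hfin : {p : Nat.Primes | ¬ IsUnit ((p : ℕ) : ZMod q)}.Finite := by
      refine ((Finset.finite_toSet q.primeFactors).preimage
        (f := fun p : Nat.Primes ↦ (p : ℕ)) Subtype.val_injective.injOn).subset fun p hp ↦ ?_
      simp only [mem_ofPred_eq, ZMod.isUnit_iff_coprime, p.2.coprime_iff_not_dvd, not_not] at hp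
      simpa using ⟨p.2, hp, NeZero.ne q⟩
    refine Nat.Primes.not_summable_one_div (h.congr_cofinite ?_)
    filter_upwards [hfin.compl_mem_cofinite] with p hp
    simp only [mem_compl_iff, mem_ofPred_eq, not_not] at hp
    simp [c, hp, Real.rpow_neg_one]
  · rw [primeSum, Complex.ofReal_tsum]
    refine tsum_congr fun p ↦ ?_
    rw [hc, Complex.ofReal_mul]

/-- A real function close to `2 Re (ū exp Λ)`, where the real and imaginary parts of `Λ` tend to
infinity at `1⁺`, takes positive values. -/
theorem exists_pos_of_sub_re_exp_isBigO {Λ : ℝ → ℂ} (hcont : ContinuousOn Λ (Ioi 1))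
    (hre : Tendsto (fun σ ↦ (Λ σ).re) (𝓝[>] 1) atTop)
    (him : Tendsto (fun σ ↦ (Λ σ).im) (𝓝[>] 1) atTop) {u : ℂ} (hu : ‖u‖ = 1) {G : ℝ → ℝ}
    (hG : (fun σ ↦ G σ - 2 * (starRingEnd ℂ u * Complex.exp (Λ σ)).re) =O[𝓝[>] 1]
      (fun _ ↦ (1 : ℝ))) : ∃ σ, 1 < σ ∧ 0 < G σ := by
  obtain ⟨C, hC⟩ := hG.bound
  obtain ⟨δ, hδ, hsub⟩ := mem_nhdsGT_iff_exists_Ioo_subset.1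
    (hC.and (hre.eventually_ge_atTop C))
  have hδ1 : 1 < δ := hδ
  obtain ⟨σ₀, hσ₀⟩ : (Ioo 1 δ).Nonempty := nonempty_Ioo.2 hδ1
  obtain ⟨k, hk⟩ := exists_nat_gt (((Λ σ₀).im - u.arg) / (2 * π))
  rw [div_lt_iff₀ two_pi_pos] at hk
  obtain ⟨σ₁, h₁, hσ₁⟩ := ((him.eventually_ge_atTop (u.arg + k * (2 * π))).and
    (Ioo_mem_nhdsGT hδ1)).exists
  obtain ⟨σ, hσ, hσk⟩ := isPreconnected_Ioo.intermediate_value hσ₀ hσ₁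
    (Complex.continuous_im.comp_continuousOn (hcont.mono fun σ hσ ↦ hσ.1))
    (show u.arg + k * (2 * π) ∈ _ from ⟨by simp only [Function.comp]; linarith, h₁⟩)
  refine ⟨σ, hσ.1, ?_⟩
  obtain ⟨hb, hexp⟩ := hsub hσ
  have hval : starRingEnd ℂ u * Complex.exp (Λ σ) = (Real.exp (Λ σ).re : ℝ) := by
    have h1 : Complex.exp (Λ σ) = (Real.exp (Λ σ).re : ℝ) * u := by
      have h2 : (Λ σ : ℂ) = ((Λ σ).re : ℂ) + (u.arg * Complex.I + k * (2 * π * Complex.I)) := by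
        conv_lhs => rw [← Complex.re_add_im (Λ σ)]
        have h3 : (Λ σ).im = u.arg + k * (2 * π) := hσk
        rw [h3]
        push_cast
        ring
      rw [h2, Complex.exp_add, Complex.exp_add, Complex.exp_nat_mul_two_pi_mul_I, mul_one,
        ← Complex.ofReal_exp]
      congr 1
      · simp
      · have := Complex.norm_mul_exp_arg_mul_I u
        rwa [hu, Complex.ofReal_one, one_mul] at this
    rw [h1, mul_left_comm, Complex.conj_mul', hu]
    simp
  rw [hval, Complex.ofReal_re, norm_one, mul_one, Real.norm_eq_abs] at hb
  have h4 := Real.add_one_le_exp (Λ σ).re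
  have h5 := (abs_le.1 hb).1
  have h6 := abs_nonneg (G σ - 2 * Real.exp (Λ σ).re)
  linarith

/-- The logarithmic form of the Euler product of a completely multiplicative function. -/
theorem cexp_primeLogSum_eq_tsum (f : ℕ →*₀ ℂ) (hf : ∀ n, ‖f n‖ ≤ 1) {σ : ℝ} (hσ : 1 < σ) :
    Complex.exp (primeLogSum (fun p ↦ f p) σ) = ∑' n : ℕ, f n * ((n : ℝ) ^ (-σ) : ℝ) := by
  obtain ⟨g, hg⟩ : ∃ g : ℕ →*₀ ℂ, ∀ n : ℕ, g n = f n * ((n : ℝ) ^ (-σ) : ℝ) := by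
    refine ⟨⟨⟨fun n ↦ f n * ((n : ℝ) ^ (-σ) : ℝ), ?_⟩, ?_, fun m n ↦ ?_⟩, fun n ↦ rfl⟩
    · simp
    · simp
    · simp only [map_mul, Nat.cast_mul, Real.mul_rpow m.cast_nonneg n.cast_nonneg]
      push_cast
      ring
  have hsum : Summable (‖g ·‖) := by
    refine .of_nonneg_of_le (fun _ ↦ norm_nonneg _) (fun n ↦ ?_)
      (Real.summable_nat_rpow.2 (show -σ < -1 by linarith))
    have := Real.rpow_nonneg n.cast_nonneg (-σ) (x := (n : ℝ))
    rw [hg, norm_mul, Complex.norm_real, Real.norm_of_nonneg this]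
    exact mul_le_of_le_one_left this (hf n)
  have := EulerProduct.exp_tsum_primes_log_eq_tsum hsum
  simpa only [hg, primeLogSum] using this

/-- The completely multiplicative function on `ℕ` with prescribed values at the primes. -/
noncomputable def completelyMultiplicative (v : ℕ → ℂ) : ℕ →*₀ ℂ where
  toFun n := if n = 0 then 0 else (n.primeFactorsList.map v).prod
  map_zero' := by simp
  map_one' := by simp
  map_mul' m n := by
    rcases eq_or_ne m 0 with rfl | hm
    · simp
    rcases eq_or_ne n 0 with rfl | hn
    · simp
    rw [if_neg hm, if_neg hn, if_neg (mul_ne_zero hm hn),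
      ((Nat.perm_primeFactorsList_mul hm hn).map v).prod_eq, List.map_append, List.prod_append]

theorem completelyMultiplicative_prime (v : ℕ → ℂ) {p : ℕ} (hp : p.Prime) :
    completelyMultiplicative v p = v p := by
  change (if p = 0 then 0 else (p.primeFactorsList.map v).prod) = v p
  simp [hp.ne_zero, Nat.primeFactorsList_prime hp]

theorem norm_completelyMultiplicative {v : ℕ → ℂ} (hv : ∀ p, p.Prime → ‖v p‖ = 1) {n : ℕ}
    (hn : n ≠ 0) : ‖completelyMultiplicative v n‖ = 1 := by
  induction n using induction_on_primes with
  | zero => exact absurd rfl hn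
  | one => simp
  | prime_mul p n hp ih =>
    rw [map_mul, norm_mul, completelyMultiplicative_prime v hp, hv p hp,
      ih (right_ne_zero_of_mul hn), one_mul]

/-- The logarithms of the primes are linearly independent over `ℤ`. -/
theorem linearIndependent_log_primes :
    LinearIndependent ℤ fun p : Nat.Primes ↦ Real.log (p : ℕ) := by
  rw [linearIndependent_iff']
  have key (s : Finset Nat.Primes) (g : Nat.Primes → ℤ)
      (hg : ∑ p ∈ s, g p • Real.log (p : ℕ) = 0) : ∀ p ∈ s, g p ≤ 0 := by
    intro p hp
    by_contra! hpos
    let P (g : Nat.Primes → ℤ) : ℕ := ∏ r ∈ s, (r : ℕ) ^ (g r).toNat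
    have hP0 (g : Nat.Primes → ℤ) : 0 < P g := Finset.prod_pos fun r _ ↦ pow_pos r.2.pos _
    have hPlog (g : Nat.Primes → ℤ) :
        Real.log (P g) = ∑ r ∈ s, ((g r).toNat : ℝ) * Real.log (r : ℕ) := by
      rw [Nat.cast_prod, Real.log_prod fun r _ ↦ by
        exact_mod_cast (pow_pos r.2.pos _).ne']
      simp [Real.log_pow]
    have heq : P g = P (-g) := by
      have : (P g : ℝ) = P (-g) := by
        refine Real.log_injOn_pos (mem_Ioi.2 (Nat.cast_pos.2 (hP0 g)))
          (mem_Ioi.2 (Nat.cast_pos.2 (hP0 (-g)))) ?_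
        rw [hPlog, hPlog, ← sub_eq_zero, ← Finset.sum_sub_distrib, ← hg]
        refine Finset.sum_congr rfl fun j _ ↦ ?_
        rw [← sub_mul, zsmul_eq_mul]
        congr 1
        have : ((g j).toNat : ℤ) - (((-g) j).toNat : ℤ) = g j := by
          rw [Pi.neg_apply]; omega
        exact_mod_cast this
      exact_mod_cast this
    have h1 : (p : ℕ) ∣ P g :=
      (dvd_pow_self _ (by omega)).trans (Finset.dvd_prod_of_mem _ hp)
    rw [heq, Prime.dvd_finsetProd_iff p.2.prime] at h1
    obtain ⟨r, -, hr⟩ := h1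
    have h2 := (Nat.prime_dvd_prime_iff_eq p.2 r.2).1 (p.2.dvd_of_dvd_pow hr)
    obtain rfl : p = r := Subtype.ext h2
    have h3 : ((-g) p).toNat = 0 := by rw [Pi.neg_apply]; omega
    rw [h3, pow_zero, Nat.dvd_one] at hr
    exact p.2.one_lt.ne' hr
  intro s g hg p hp
  have h1 := key s g hg p hp
  have h2 := key s (-g) (by simpa using hg) p hp
  rw [Pi.neg_apply] at h2
  omega

/-- Kronecker's theorem for completely multiplicative functions of absolute value one. -/
theorem exists_filter_tendsto_natCast_cpow (f : ℕ →*₀ ℂ) (hf : ∀ n ≠ 0, ‖f n‖ = 1) :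
    ∃ l : Filter ℝ, l.NeBot ∧ l ≤ atTop ∧ ∀ n : ℕ, n ≠ 0 →
      Tendsto (fun t : ℝ ↦ (n : ℂ) ^ (-(t * Complex.I))) l (𝓝 (f n)) := by
  obtain ⟨l, hl, hle, hlim⟩ := exists_filter_tendsto_cexp_of_linearIndependent
    linearIndependent_log_primes (θ := fun p ↦ f p) fun p ↦ hf _ p.2.ne_zero
  refine ⟨l, hl, hle, fun n hn ↦ ?_⟩
  induction n using induction_on_primes with
  | zero => exact absurd rfl hn
  | one => simp
  | prime_mul p n hp ih =>
    have h1 := hlim ⟨p, hp⟩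
    have hp0 : (0 : ℝ) < p := by exact_mod_cast hp.pos
    simp only [← ofReal_cpow_neg_mul_I hp0, Complex.ofReal_natCast] at h1
    rw [map_mul]
    refine (h1.mul (ih (right_ne_zero_of_mul hn))).congr fun t ↦ ?_
    rw [Nat.cast_mul, Complex.natCast_mul_natCast_cpow]

/-- A nontrivial quadratic character modulo `q` exists for `q > 2`. -/
theorem exists_dirichletCharacter_sq_eq_one {q : ℕ} [NeZero q] (hq : 2 < q) :
    ∃ χ : DirichletCharacter ℂ q, χ ≠ 1 ∧ χ ^ 2 = 1 := by
  have hcard := DirichletCharacter.card_eq_totient_of_hasEnoughRootsOfUnity ℂ q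
  have : Fact (Nat.Prime 2) := ⟨Nat.prime_two⟩
  obtain ⟨χ, hχ⟩ := exists_prime_orderOf_dvd_card' (G := DirichletCharacter ℂ q) 2
    (hcard ▸ (Nat.totient_even hq).two_dvd)
  refine ⟨χ, fun h ↦ ?_, ?_⟩
  · rw [h, orderOf_one] at hχ
    omega
  · rw [← hχ, pow_orderOf_eq_one]

theorem cexp_primeLogSum_mul_eq_tsum {q : ℕ} (χ : DirichletCharacter ℂ q) (f : ℕ →*₀ ℂ)
    (hf : ∀ n, ‖f n‖ ≤ 1) {σ : ℝ} (hσ : 1 < σ) :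
    Complex.exp (primeLogSum (fun p ↦ χ (p : ℕ) * f p) σ) =
      ∑' n : ℕ, χ n * (f n * ((n : ℝ) ^ (-σ) : ℝ)) := by
  obtain ⟨g, hg⟩ : ∃ g : ℕ →*₀ ℂ, ∀ n : ℕ, g n = χ n * f n := by
    refine ⟨⟨⟨fun n ↦ χ n * f n, ?_⟩, ?_, fun m n ↦ ?_⟩, fun n ↦ rfl⟩
    · simp
    · simp
    · simp only [map_mul, Nat.cast_mul]
      ring
  have := cexp_primeLogSum_eq_tsum g (fun n ↦ by
    rw [hg, norm_mul]
    exact mul_le_one₀ (χ.norm_le_one _) (norm_nonneg _) (hf n)) hσ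
  simpa only [hg, mul_assoc] using this

/-- Detection of a residue class by Dirichlet characters. -/
theorem totient_mul_tsum_mul_add {q : ℕ} [NeZero q] {a : ℕ} (haq : a.Coprime q) (ha : a < q)
    {g : ℕ → ℂ} (hg : Summable g) :
    (q.totient : ℂ) * ∑' n : ℕ, g (q * n + a) =
      ∑ χ : DirichletCharacter ℂ q, χ (a : ZMod q)⁻¹ * ∑' n : ℕ, χ n * g n := by
  have hsum (χ : DirichletCharacter ℂ q) :
      Summable fun n : ℕ ↦ χ (a : ZMod q)⁻¹ * (χ n * g n) := by
    refine .mul_left _ (.of_norm_bounded hg.norm fun n ↦ ?_)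
    rw [norm_mul]
    exact mul_le_of_le_one_left (norm_nonneg _) (χ.norm_le_one _)
  rw [Finset.sum_congr rfl fun χ _ ↦ tsum_mul_left.symm, ← Summable.tsum_finsetSum fun χ _ ↦ hsum χ]
  have hinj : Function.Injective fun n : ℕ ↦ q * n + a := fun m n h ↦
    Nat.eq_of_mul_eq_mul_left (NeZero.pos q) (Nat.add_right_cancel h)
  have key (n : ℕ) : ∑ χ : DirichletCharacter ℂ q, χ (a : ZMod q)⁻¹ * (χ n * g n) =
      if (a : ZMod q) = n then q.totient * g n else 0 := by
    simp_rw [← mul_assoc, ← Finset.sum_mul]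
    rw [DirichletCharacter.sum_char_inv_mul_char_eq ℂ ((ZMod.isUnit_iff_coprime _ _).2 haq)]
    split_ifs <;> simp
  simp_rw [key]
  rw [← hinj.tsum_eq (f := fun n : ℕ ↦ if (a : ZMod q) = n then q.totient * g n else 0),
    ← tsum_mul_left]
  · exact tsum_congr fun n ↦ by simp
  · intro n hn
    have h1 : (a : ZMod q) = n := by
      by_contra h
      simp [h] at hn
    rw [ZMod.natCast_eq_natCast_iff', Nat.mod_eq_of_lt ha] at h1
    exact ⟨n / q, by simp only; rw [h1, Nat.div_add_mod]⟩

section QuadraticTwist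

variable {q : ℕ} {χ₁ : DirichletCharacter ℂ q} {f : ℕ →*₀ ℂ} {c c' : ℂ}

theorem norm_dirichletCharacter_mul_le_one (hf : ∀ n, ‖f n‖ ≤ 1) (χ : DirichletCharacter ℂ q)
    (p : Nat.Primes) : ‖χ (p : ℕ) * f p‖ ≤ 1 := by
  rw [norm_mul]
  exact mul_le_one₀ (χ.norm_le_one _) (norm_nonneg _) (hf p)

theorem primeSum_twist_eq
    (hfp : ∀ (χ : DirichletCharacter ℂ q) (p : Nat.Primes),
      χ (p : ℕ) * f p = c * χ (p : ℕ) + c' * (χ * χ₁) (p : ℕ))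
    (χ : DirichletCharacter ℂ q) {σ : ℝ} (hσ : 1 < σ) :
    primeSum (fun p ↦ χ (p : ℕ) * f p) σ =
      c * primeSum (fun p ↦ χ (p : ℕ)) σ + c' * primeSum (fun p ↦ (χ * χ₁) (p : ℕ)) σ :=
  primeSum_eq_mul_add_mul (fun _ ↦ χ.norm_le_one _) (fun _ ↦ (χ * χ₁).norm_le_one _) (hfp χ) hσ

theorem cexp_primeLogSum_twist_isBigO [NeZero q] (hf : ∀ n, ‖f n‖ ≤ 1)
    (hfp : ∀ (χ : DirichletCharacter ℂ q) (p : Nat.Primes),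
      χ (p : ℕ) * f p = c * χ (p : ℕ) + c' * (χ * χ₁) (p : ℕ))
    {χ : DirichletCharacter ℂ q} (hχ : χ ≠ 1) (hχ₁ : χ * χ₁ ≠ 1) :
    (fun σ ↦ Complex.exp (primeLogSum (fun p ↦ χ (p : ℕ) * f p) σ)) =O[𝓝[>] 1]
      (fun _ ↦ (1 : ℝ)) := by
  have h1 := ((primeSum_dirichletCharacter_isBigO hχ).const_mul_left c).add
    ((primeSum_dirichletCharacter_isBigO hχ₁).const_mul_left c')
  have h2 : (fun σ ↦ primeLogSum (fun p ↦ χ (p : ℕ) * f p) σ) =O[𝓝[>] 1] (fun _ ↦ (1 : ℝ)) := by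
    refine (h1.add (primeLogSum_sub_primeSum_isBigO
      (norm_dirichletCharacter_mul_le_one hf χ))).congr' ?_ .rfl
    filter_upwards [self_mem_nhdsWithin] with σ hσ
    rw [primeSum_twist_eq hfp χ hσ]
    ring
  obtain ⟨C, hC⟩ := h2.bound
  refine .of_bound (Real.exp C) ?_
  filter_upwards [hC] with σ hσ
  rw [norm_one, mul_one] at hσ ⊢
  exact (Complex.norm_exp_le_exp_norm _).trans (Real.exp_le_exp.2 hσ)

theorem primeLogSum_twist_one_sub_isBigO [NeZero q] (hf : ∀ n, ‖f n‖ ≤ 1)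
    (hfp : ∀ (χ : DirichletCharacter ℂ q) (p : Nat.Primes),
      χ (p : ℕ) * f p = c * χ (p : ℕ) + c' * (χ * χ₁) (p : ℕ))
    (hχ₁ : χ₁ ≠ 1) :
    (fun σ ↦ primeLogSum (fun p ↦ (1 : DirichletCharacter ℂ q) (p : ℕ) * f p) σ -
      c * primeSum (fun p ↦ (1 : DirichletCharacter ℂ q) (p : ℕ)) σ) =O[𝓝[>] 1]
      (fun _ ↦ (1 : ℝ)) := by
  refine (((primeSum_dirichletCharacter_isBigO (χ := 1 * χ₁) (by rwa [one_mul])).const_mul_left c').add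
    (primeLogSum_sub_primeSum_isBigO
      (norm_dirichletCharacter_mul_le_one hf (1 : DirichletCharacter ℂ q)))).congr' ?_ .rfl
  filter_upwards [self_mem_nhdsWithin] with σ hσ
  rw [primeSum_twist_eq hfp 1 hσ]
  ring

end QuadraticTwist

/-- If `Λ - c P` is bounded near `1⁺`, `P → ∞` is real and `L c > 0` for a real linear functional
`L`, then `L Λ → ∞`. -/
theorem tendsto_atTop_of_sub_mul_ofReal_isBigO {Λ : ℝ → ℂ} {P : ℝ → ℝ} {c : ℂ} {l : Filter ℝ}
    (hP : Tendsto P l atTop) (hΛ : (fun σ ↦ Λ σ - c * P σ) =O[l] (fun _ ↦ (1 : ℝ)))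
    (L : ℂ →L[ℝ] ℝ) (hL : 0 < L c) : Tendsto (fun σ ↦ L (Λ σ)) l atTop := by
  obtain ⟨C, hC⟩ := ((L.isBigO_comp _ l).trans hΛ).bound
  refine tendsto_atTop_mono' l ?_
    (tendsto_atTop_add_const_right l (-C) (hP.const_mul_atTop hL))
  filter_upwards [hC] with σ hσ
  rw [norm_one, mul_one, Real.norm_eq_abs, map_sub, mul_comm c, ← Complex.real_smul, map_smul,
    smul_eq_mul] at hσ
  linarith [(abs_le.1 hσ).1]

/-- A completely multiplicative square root of a quadratic character `χ` away from its modulus. -/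
noncomputable def quadraticRoot {q : ℕ} (χ : DirichletCharacter ℂ q) : ℕ →*₀ ℂ :=
  completelyMultiplicative fun n ↦ if χ n = -1 then Complex.I else 1

section QuadraticRoot

variable {q : ℕ} {χ : DirichletCharacter ℂ q}

theorem norm_quadraticRoot {n : ℕ} (hn : n ≠ 0) : ‖quadraticRoot χ n‖ = 1 :=
  norm_completelyMultiplicative (fun p _ ↦ by split_ifs <;> simp) hn

theorem norm_quadraticRoot_le_one (n : ℕ) : ‖quadraticRoot χ n‖ ≤ 1 := by
  rcases eq_or_ne n 0 with rfl | hn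
  · simp
  · exact (norm_quadraticRoot hn).le

theorem quadraticRoot_prime {p : ℕ} (hp : p.Prime) :
    quadraticRoot χ p = if χ p = -1 then Complex.I else 1 :=
  completelyMultiplicative_prime _ hp

theorem apply_mul_self_of_sq_eq_one (hχ : χ ^ 2 = 1) {n : ℕ} (hn : n.Coprime q) :
    χ n * χ n = 1 := by
  rw [← pow_two, ← MulChar.pow_apply' _ two_ne_zero, hχ,
    MulChar.one_apply ((ZMod.isUnit_iff_coprime _ _).2 hn)]

theorem apply_eq_zero_of_not_coprime {ψ : DirichletCharacter ℂ q} {n : ℕ} (hn : ¬ n.Coprime q) :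
    ψ n = 0 :=
  MulChar.map_nonunit _ fun h ↦ hn ((ZMod.isUnit_iff_coprime _ _).1 h)

theorem quadraticRoot_mul_self (hχ : χ ^ 2 = 1) {n : ℕ} (hn0 : n ≠ 0) (hn : n.Coprime q) :
    quadraticRoot χ n * quadraticRoot χ n = χ n := by
  induction n using induction_on_primes with
  | zero => exact absurd rfl hn0
  | one => simp
  | prime_mul p n hp ih =>
    rw [Nat.coprime_mul_iff_left] at hn
    rw [map_mul, mul_mul_mul_comm, ih (right_ne_zero_of_mul hn0) hn.2, quadraticRoot_prime hp,
      Nat.cast_mul, map_mul]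
    congr 1
    rcases mul_self_eq_one_iff.1 (apply_mul_self_of_sq_eq_one hχ hn.1) with h | h
    · rw [h, if_neg (by norm_num)]
      simp
    · simp [h]

theorem conj_quadraticRoot (hχ : χ ^ 2 = 1) {n : ℕ} (hn0 : n ≠ 0) (hn : n.Coprime q) :
    starRingEnd ℂ (quadraticRoot χ n) = χ n * quadraticRoot χ n := by
  have h1 : starRingEnd ℂ (quadraticRoot χ n) * quadraticRoot χ n = 1 := by
    rw [Complex.conj_mul', norm_quadraticRoot hn0]
    simp
  have h2 := apply_mul_self_of_sq_eq_one hχ hn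
  have h3 := quadraticRoot_mul_self hχ hn0 hn
  linear_combination (-starRingEnd ℂ (quadraticRoot χ n)) * h2 +
    χ n * quadraticRoot χ n * h1 - starRingEnd ℂ (quadraticRoot χ n) * χ n * h3

theorem mul_quadraticRoot_prime (hχ : χ ^ 2 = 1) (ψ : DirichletCharacter ℂ q) (p : Nat.Primes) :
    ψ (p : ℕ) * quadraticRoot χ p =
      (1 + Complex.I) / 2 * ψ (p : ℕ) + (1 - Complex.I) / 2 * (ψ * χ) (p : ℕ) := by
  by_cases hp : (p : ℕ).Coprime q
  · rw [quadraticRoot_prime p.2, MulChar.mul_apply]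
    rcases mul_self_eq_one_iff.1 (apply_mul_self_of_sq_eq_one hχ hp) with h | h
    · rw [h, if_neg (by norm_num)]
      ring
    · rw [h, if_pos rfl]
      ring
  · simp [apply_eq_zero_of_not_coprime hp]

theorem cexp_primeLogSum_self_mul_quadraticRoot (hq : q ≠ 1) (hχ : χ ^ 2 = 1) {σ : ℝ}
    (hσ : 1 < σ) :
    Complex.exp (primeLogSum (fun p ↦ χ (p : ℕ) * quadraticRoot χ p) σ) =
      starRingEnd ℂ (Complex.exp (primeLogSum
        (fun p ↦ (1 : DirichletCharacter ℂ q) (p : ℕ) * quadraticRoot χ p) σ)) := by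
  rw [cexp_primeLogSum_mul_eq_tsum _ _ norm_quadraticRoot_le_one hσ,
    cexp_primeLogSum_mul_eq_tsum _ _ norm_quadraticRoot_le_one hσ, Complex.conj_tsum]
  refine tsum_congr fun n ↦ ?_
  by_cases hn : n.Coprime q
  · have hn0 : n ≠ 0 := by
      rintro rfl
      exact hq (by simpa using hn)
    rw [map_mul, map_mul, conj_quadraticRoot hχ hn0 hn, Complex.conj_ofReal,
      MulChar.one_apply ((ZMod.isUnit_iff_coprime _ _).2 hn), map_one, one_mul, mul_assoc]
  · simp [apply_eq_zero_of_not_coprime hn]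

/-- The sum over a residue class is `2 Re (ū exp Λ)` up to a bounded error, where `exp Λ` is the
Euler product of `quadraticRoot χ`. -/
theorem totient_mul_tsum_sub_re_isBigO [NeZero q] (hq : q ≠ 1) (hχ : χ ^ 2 = 1) (hχ1 : χ ≠ 1)
    {a : ℕ} (haq : a.Coprime q) (ha : a < q) {ρ : ℕ → ℝ}
    (hρ : ∀ n, quadraticRoot χ (q * n + a) = quadraticRoot χ a * ρ n) :
    (fun σ ↦ q.totient * ∑' n : ℕ, ρ n * ((q * n + a : ℕ) : ℝ) ^ (-σ) -
      2 * (starRingEnd ℂ (quadraticRoot χ a) * Complex.exp (primeLogSum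
        (fun p ↦ (1 : DirichletCharacter ℂ q) (p : ℕ) * quadraticRoot χ p) σ)).re)
      =O[𝓝[>] 1] (fun _ ↦ (1 : ℝ)) := by
  classical
  set f := quadraticRoot χ with hf
  set u := f a with hu
  have ha0 : a ≠ 0 := by
    rintro rfl
    exact hq (by simpa using haq)
  have hconj : starRingEnd ℂ u * u = 1 := by
    rw [Complex.conj_mul', norm_quadraticRoot ha0]
    simp
  have hunit := (ZMod.isUnit_iff_coprime a q).2 haq
  let E (ψ : DirichletCharacter ℂ q) (σ : ℝ) : ℂ :=
    Complex.exp (primeLogSum (fun p ↦ ψ (p : ℕ) * f p) σ)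
  let R : Finset (DirichletCharacter ℂ q) := (Finset.univ.erase 1).erase χ
  have hinvχ : χ (a : ZMod q)⁻¹ = χ a := by
    have h1 : χ (a : ZMod q)⁻¹ * χ a = 1 := by
      rw [← map_mul, ZMod.inv_mul_of_unit _ hunit, map_one]
    linear_combination χ a * h1 - χ (a : ZMod q)⁻¹ * apply_mul_self_of_sq_eq_one hχ haq
  have hinv1 : (1 : DirichletCharacter ℂ q) (a : ZMod q)⁻¹ = 1 := by
    have h1 : (1 : DirichletCharacter ℂ q) (a : ZMod q)⁻¹ *
        (1 : DirichletCharacter ℂ q) (a : ZMod q) = 1 := by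
      rw [← map_mul, ZMod.inv_mul_of_unit _ hunit, map_one]
    rwa [MulChar.one_apply hunit, mul_one] at h1
  have hmain {σ : ℝ} (hσ : 1 < σ) :
      ((q.totient * ∑' n : ℕ, ρ n * ((q * n + a : ℕ) : ℝ) ^ (-σ) : ℝ) : ℂ) =
        (2 * (starRingEnd ℂ u * E 1 σ).re : ℝ) +
          ∑ ψ ∈ R, starRingEnd ℂ u * ψ (a : ZMod q)⁻¹ * E ψ σ := by
    have hsum : Summable fun n : ℕ ↦ f n * ((n : ℝ) ^ (-σ) : ℝ) := by
      refine .of_norm_bounded (Real.summable_nat_rpow.2 (show -σ < -1 by linarith)) fun n ↦ ?_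
      have := Real.rpow_nonneg n.cast_nonneg (-σ) (x := (n : ℝ))
      rw [norm_mul, Complex.norm_real, Real.norm_of_nonneg this]
      exact mul_le_of_le_one_left this (norm_quadraticRoot_le_one n)
    have h1 := totient_mul_tsum_mul_add haq ha hsum
    simp_rw [← cexp_primeLogSum_mul_eq_tsum _ f norm_quadraticRoot_le_one hσ] at h1
    rw [← Finset.add_sum_erase _ _ (Finset.mem_univ 1),
      ← Finset.add_sum_erase _ _ (Finset.mem_erase.2 ⟨hχ1, Finset.mem_univ χ⟩), hinv1, hinvχ,
      cexp_primeLogSum_self_mul_quadraticRoot hq hχ hσ] at h1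
    have h2 : ((q.totient * ∑' n : ℕ, ρ n * ((q * n + a : ℕ) : ℝ) ^ (-σ) : ℝ) : ℂ) =
        starRingEnd ℂ u *
          (q.totient * ∑' n : ℕ, f (q * n + a) * (((q * n + a : ℕ) : ℝ) ^ (-σ) : ℝ)) := by
      simp_rw [hρ, mul_assoc, tsum_mul_left]
      rw [Complex.ofReal_mul, Complex.ofReal_tsum]
      push_cast
      linear_combination (-(q.totient : ℂ) *
        ∑' n : ℕ, (ρ n : ℂ) * (((q * n + a : ℝ) ^ (-σ) : ℝ) : ℂ)) * hconj
    have h3 : starRingEnd ℂ u * χ a = u := by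
      rw [conj_quadraticRoot hχ ha0 haq]
      linear_combination u * apply_mul_self_of_sq_eq_one hχ haq
    have h4 : ((2 * (starRingEnd ℂ u * E 1 σ).re : ℝ) : ℂ) =
        starRingEnd ℂ u * E 1 σ + u * starRingEnd ℂ (E 1 σ) := by
      rw [← Complex.add_conj, map_mul, Complex.conj_conj]
    rw [h2, h1, h4]
    simp_rw [mul_assoc]
    rw [← Finset.mul_sum]
    linear_combination starRingEnd ℂ (E 1 σ) * h3
  have hR : (fun σ ↦ ∑ ψ ∈ R, starRingEnd ℂ u * ψ (a : ZMod q)⁻¹ * E ψ σ) =O[𝓝[>] 1]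
      (fun _ ↦ (1 : ℝ)) := by
    refine Asymptotics.IsBigO.fun_sum fun ψ hψ ↦ ?_
    obtain ⟨hψχ, hψ1⟩ : ψ ≠ χ ∧ ψ ≠ 1 := by simpa [R] using hψ
    refine (cexp_primeLogSum_twist_isBigO norm_quadraticRoot_le_one
      (mul_quadraticRoot_prime hχ) hψ1 fun h ↦ hψχ ?_).const_mul_left _
    rw [← mul_one ψ, ← hχ, pow_two, ← mul_assoc, h, one_mul]
  refine (Complex.reCLM.isBigO_comp _ _).trans hR |>.congr' ?_ .rfl
  filter_upwards [self_mem_nhdsWithin] with σ hσ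
  have := congr_arg Complex.re (hmain hσ)
  rw [Complex.ofReal_re, Complex.add_re, Complex.ofReal_re] at this
  rw [this, add_sub_cancel_left]
  rfl

end QuadraticRoot

theorem infinite_zeros_of_div {q a : ℕ} (hq : 2 < q) (ha : a < q) (haq : a.Coprime q) :
    {s : ℂ | 1 < s.re ∧ hurwitzZeta (((a / q : ℝ) : ℝ) : UnitAddCircle) s = 0}.Infinite := by
  have : NeZero q := ⟨by omega⟩
  have hq1 : q ≠ 1 := by omega
  have hq0 : (0 : ℝ) < q := by exact_mod_cast NeZero.pos q
  have ha0 : a ≠ 0 := by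
    rintro rfl
    exact hq1 (by simpa using haq)
  have ha0' : (0 : ℝ) < a := by exact_mod_cast Nat.pos_of_ne_zero ha0
  obtain ⟨χ, hχ1, hχ⟩ := exists_dirichletCharacter_sq_eq_one hq
  set f := quadraticRoot χ with hf
  have hnorm : ‖f a‖ = 1 := norm_quadraticRoot ha0
  have hcop (n : ℕ) : (q * n + a).Coprime q := by simpa using haq
  have hρ (n : ℕ) : ∃ r : ℝ, |r| = 1 ∧ f (q * n + a) = f a * r := by
    have h1 := quadraticRoot_mul_self hχ (n := q * n + a) (by omega) (hcop n)
    have h2 : ((q * n + a : ℕ) : ZMod q) = a := by simp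
    rw [h2, ← quadraticRoot_mul_self hχ ha0 haq] at h1
    rcases mul_self_eq_mul_self_iff.1 h1 with h | h
    · exact ⟨1, by simp, by simpa using h⟩
    · exact ⟨-1, by simp, by simpa using h⟩
  choose ρ hρ1 hρ using hρ
  obtain ⟨l, hl, hle, hlim⟩ := exists_filter_tendsto_natCast_cpow f fun n hn ↦ norm_quadraticRoot hn
  set Λ : ℝ → ℂ := primeLogSum fun p ↦ (1 : DirichletCharacter ℂ q) (p : ℕ) * f p with hΛ
  have hcont : ContinuousOn Λ (Ioi 1) := continuousOn_primeLogSum fun p ↦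
    norm_dirichletCharacter_mul_le_one norm_quadraticRoot_le_one _ p
  obtain ⟨P, hP, hP1⟩ := exists_primeSum_one_eq_ofReal q
  have hO := primeLogSum_twist_one_sub_isBigO norm_quadraticRoot_le_one
    (mul_quadraticRoot_prime hχ) hχ1
  simp_rw [hP1] at hO
  have hre : Tendsto (fun σ ↦ (Λ σ).re) (𝓝[>] 1) atTop :=
    tendsto_atTop_of_sub_mul_ofReal_isBigO hP hO Complex.reCLM (by simp)
  have him : Tendsto (fun σ ↦ (Λ σ).im) (𝓝[>] 1) atTop :=
    tendsto_atTop_of_sub_mul_ofReal_isBigO hP hO Complex.imCLM (by simp)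
  have hG := totient_mul_tsum_sub_re_isBigO hq1 hχ hχ1 haq ha hρ
  obtain ⟨σ₂, hσ₂, h₂⟩ := exists_pos_of_sub_re_exp_isBigO hcont hre him hnorm hG
  obtain ⟨σ₁, hσ₁, h₁⟩ := exists_pos_of_sub_re_exp_isBigO hcont hre him
    (u := -f a) (by rwa [norm_neg])
    (G := fun σ ↦ -(q.totient * ∑' n : ℕ, ρ n * ((q * n + a : ℕ) : ℝ) ^ (-σ)))
    (hG.neg_left.congr_left fun σ ↦ by
      rw [map_neg, neg_mul, Complex.neg_re]
      ring)
  have htot : (0 : ℝ) < q.totient := by exact_mod_cast Nat.totient_pos.2 (NeZero.pos q)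
  have hscale (σ : ℝ) : ∑' n : ℕ, ρ n * ((n : ℝ) + a / q) ^ (-σ) =
      (q : ℝ) ^ σ * ∑' n : ℕ, ρ n * ((q * n + a : ℕ) : ℝ) ^ (-σ) := by
    rw [← tsum_mul_left]
    refine tsum_congr fun n ↦ ?_
    have h1 : (n : ℝ) + a / q = ((q * n + a : ℕ) : ℝ) * (q : ℝ)⁻¹ := by
      push_cast
      field_simp
    rw [h1, Real.mul_rpow (Nat.cast_nonneg _) (inv_nonneg.2 hq0.le), Real.inv_rpow hq0.le,
      Real.rpow_neg hq0.le, inv_inv]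
    ring
  refine infinite_zeros_of_sign_change (l := l) (w := f a / f q) (ρ := ρ) (σ₁ := σ₁) (σ₂ := σ₂)
    ⟨by positivity, (div_lt_one hq0).2 (by exact_mod_cast ha)⟩ hle ?_ (fun n ↦ (hρ1 n).le)
    (fun n ↦ ?_) hσ₁ hσ₂ ?_ ?_
  · exact div_ne_zero (norm_ne_zero_iff.1 (by simp [hnorm]))
      (norm_ne_zero_iff.1 (by simp [hf, norm_quadraticRoot (NeZero.ne q)]))
  · have h1 := (hlim (q * n + a) (by omega)).div (hlim q (NeZero.ne q))
      (norm_ne_zero_iff.1 (by simp [hf, norm_quadraticRoot (NeZero.ne q)]))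
    rw [hρ, mul_div_right_comm] at h1
    refine h1.congr fun t ↦ ?_
    have h2 : (((n : ℝ) + (a / q : ℝ) : ℝ) : ℂ) = (((q * n + a : ℕ) : ℝ) / (q : ℝ) : ℝ) := by
      congr 1
      push_cast
      field_simp
    rw [Pi.div_apply, h2, Complex.ofReal_div, div_eq_mul_inv, div_eq_mul_inv,
      ← Complex.ofReal_inv, Complex.mul_cpow_ofReal_nonneg (Nat.cast_nonneg _)
      (inv_nonneg.2 hq0.le), Complex.ofReal_inv, Complex.inv_cpow]
    · simp
    · simp [Real.pi_pos.ne]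
  · rw [hscale]
    exact mul_neg_of_pos_of_neg (Real.rpow_pos_of_pos hq0 _)
      (neg_of_mul_neg_right (neg_pos.1 h₁) htot.le)
  · rw [hscale]
    exact mul_pos (Real.rpow_pos_of_pos hq0 _) (pos_of_mul_pos_right h₂ htot.le)

theorem infinite_zeros_of_rat {r : ℚ} (hr0 : 0 < r) (hr1 : r < 1) (hr : r ≠ 1 / 2) :
    {s : ℂ | 1 < s.re ∧ hurwitzZeta ((r : ℝ) : UnitAddCircle) s = 0}.Infinite := by
  have hnum : 0 < r.num := Rat.num_pos.2 hr0
  have hnat : (r.num.natAbs : ℤ) = r.num := Int.natAbs_of_nonneg hnum.le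
  have hr' : (r.num.natAbs : ℚ) / r.den = r := by
    conv_rhs => rw [← Rat.num_div_den r, ← hnat]
    simp
  have hlt : r.num.natAbs < r.den := by
    have := Rat.num_lt_denom_iff.2 hr1
    omega
  have hden : 2 < r.den := by
    by_contra! h
    have h1 : r.den = 2 := by omega
    have h2 : r.num.natAbs = 1 := by omega
    rw [h1, h2] at hr'
    exact hr (by rw [← hr']; norm_num)
  have := infinite_zeros_of_div hden hlt r.reduced
  rwa [show ((r.num.natAbs : ℝ) / r.den : ℝ) = (r : ℝ) by
    conv_rhs => rw [← hr']
    push_cast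
    rfl] at this

/-- Davenport–Heilbronn: for `α ∈ (0,1)` with `α ≠ 1/2`, rational or transcendental, the Hurwitz
zeta function `ζ(s,α)` has infinitely many zeros in the half-plane `Re s > 1`. -/
theorem hurwitzZeta_infinitely_many_zeros_right_of_one (α : ℝ)
    (hα : α ∈ Set.Ioo (0 : ℝ) 1) (hhalf : α ≠ 1 / 2)
    (hrt : (∃ q : ℚ, α = (q : ℝ)) ∨ Transcendental ℚ α) :
    {s : ℂ | 1 < s.re ∧ hurwitzZeta ((α : ℝ) : UnitAddCircle) s = 0}.Infinite := by
  rcases hrt with ⟨r, rfl⟩ | htr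
  · refine infinite_zeros_of_rat (by exact_mod_cast hα.1) (by exact_mod_cast hα.2) fun h ↦
      hhalf ?_
    rw [h]
    norm_num
  · exact infinite_zeros_of_transcendental hα htr
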